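/- There exists c₀ > 0 such that for every real c with 0 < c < c₀ there exists ε₀ > 0 such that for every real ε with 0 < ε < ε₀ there exists n₀ such that the following holds for all integers n ≥ n₀ and m with n/27 < m < (1−c)n/3: let F = {F_1, ..., F_m} be a stable family of 3-graphs on vertex set [n] such that for every i ∈ [m], |F_i| > f(n,m,3) and d_{F_i}(v) ≤ C(n−1,2) − C(n−3(m−1)−1, 2) for every v ∈ [n]. If H(F) is not ε-close to H_S(n,m,3) and H(F) is not ε-close to H_D(n,m,3), then F admits a rainbow matching. -/

import Mathlib

open Finset

/-- `f(n,m,k) = max{C(n,k) - C(n-m+1,k), C(km-1,k)}`. -/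
def fEMC (n m k : ℕ) : ℕ :=
  max (Nat.choose n k - Nat.choose (n - m + 1) k) (Nat.choose (k * m - 1) k)

/-- `F` is a `k`-graph on the vertex set `[n] = {1,…,n}`. -/
def IsKGraphOn (n k : ℕ) (F : Finset (Finset ℕ)) : Prop :=
  ∀ e ∈ F, e ⊆ Finset.Icc 1 n ∧ e.card = k

/-- The family `F = (F_1,…,F_m)` admits a rainbow matching. -/
def HasRainbowMatching {m : ℕ} (F : Fin m → Finset (Finset ℕ)) : Prop :=
  ∃ e : Fin m → Finset ℕ, (∀ i, e i ∈ F i) ∧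
    ∀ i j : Fin m, i ≠ j → Disjoint (e i) (e j)

/-- Degree of a vertex `v` in the hypergraph `F`. -/
def degOf (F : Finset (Finset ℕ)) (v : ℕ) : ℕ := (F.filter (fun e => v ∈ e)).card

/-- The family `F` of `k`-graphs on `[n]` is saturated. -/
def Saturated (n k : ℕ) {m : ℕ} (F : Fin m → Finset (Finset ℕ)) : Prop :=
  ¬ HasRainbowMatching F ∧
    ∀ (i : Fin m) (e : Finset ℕ), e ⊆ Finset.Icc 1 n → e.card = k → e ∉ F i →
      HasRainbowMatching (Function.update F i (insert e (F i)))

/-- Elementwise domination order: the increasing enumeration of `e` is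
pointwise at most that of `f` (this forces `e.card = f.card`). -/
def DomLE (e f : Finset ℕ) : Prop :=
  List.Forall₂ (· ≤ ·) (e.sort (· ≤ ·)) (f.sort (· ≤ ·))

/-- `F` is a stable hypergraph on vertex set `[n]`. -/
def StableGraph (n : ℕ) (F : Finset (Finset ℕ)) : Prop :=
  ∀ e f : Finset ℕ, e ⊆ Finset.Icc 1 n → DomLE e f → f ∈ F → e ∈ F

/-- `S(n,m,k)`: all `k`-subsets of `[n]` meeting `[m-1]`. -/
def SGraph (n m k : ℕ) : Finset (Finset ℕ) :=
  ((Finset.Icc 1 n).powersetCard k).filter (fun e => (e ∩ Finset.Icc 1 (m - 1)).Nonempty)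

/-- `D(n,m,k)`: all `k`-subsets of `[km-1]`. -/
def DGraph (n m k : ℕ) : Finset (Finset ℕ) :=
  (Finset.Icc 1 (k * m - 1)).powersetCard k

/-- `H(F)`: the `(k+1)`-graph on `[n] ∪ {v_1,…,v_m}`, where `v_i` is encoded
as the natural number `n + i`, with edges `e ∪ {v_i}` for `e ∈ F_i`. -/
def HF (n : ℕ) {m : ℕ} (F : Fin m → Finset (Finset ℕ)) : Finset (Finset ℕ) :=
  Finset.univ.biUnion (fun i : Fin m => (F i).image (fun e => insert (n + i.1 + 1) e))

/-- `H_S(n,m,k) = H(F)` with every `F_i = S(n,m,k)`. -/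
def HS (n m k : ℕ) : Finset (Finset ℕ) := HF n (fun _ : Fin m => SGraph n m k)

/-- `H_D(n,m,k) = H(F)` with every `F_i = D(n,m,k)`. -/
def HD (n m k : ℕ) : Finset (Finset ℕ) := HF n (fun _ : Fin m => DGraph n m k)

/-- `H*(F)`: `H(F)` together with the edges `e ∪ {u_j}`, `e` a `k`-subset of `[n]`,
`j ∈ [r]`, `r = ⌊n/k⌋ - m`, where `u_j` is encoded as the natural number `n + m + j`. -/
def HstarF (n k : ℕ) {m : ℕ} (F : Fin m → Finset (Finset ℕ)) : Finset (Finset ℕ) :=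
  HF n F ∪ Finset.univ.biUnion (fun j : Fin (n / k - m) =>
    ((Finset.Icc 1 n).powersetCard k).image (fun e => insert (n + m + j.1 + 1) e))

/-- A set of edges is a matching if its edges are pairwise disjoint. -/
def IsMatching (M : Finset (Finset ℕ)) : Prop :=
  ∀ e ∈ M, ∀ f ∈ M, e ≠ f → Disjoint e f

/-- `H₂` is `ε`-close to `H₁` (as `u`-graphs on a vertex set of size `N`):
`|E(H₁) \ E(H₂)| ≤ ε · N^u`. -/
def IsEpsClose (ε : ℝ) (N u : ℕ) (H₁ H₂ : Finset (Finset ℕ)) : Prop :=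
  (((H₁ \ H₂).card : ℝ)) ≤ ε * (N : ℝ) ^ u

noncomputable def ind (t : ℝ) : ℝ := if 1 ≤ t then 1 else 0

lemma ind_nonneg (t : ℝ) : 0 ≤ ind t := by unfold ind; split_ifs <;> norm_num
lemma ind_le_one (t : ℝ) : ind t ≤ 1 := by unfold ind; split_ifs <;> norm_num
lemma ind_of_le {t : ℝ} (h : 1 ≤ t) : ind t = 1 := by unfold ind; rw [if_pos h]
lemma ind_of_lt {t : ℝ} (h : t < 1) : ind t = 0 := by unfold ind; rw [if_neg (not_le.2 h)]
lemma ind_mono {s t : ℝ} (h : s ≤ t) : ind s ≤ ind t := by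
  rcases lt_or_ge s 1 with hs | hs
  · rw [ind_of_lt hs]; exact ind_nonneg t
  · rw [ind_of_le hs, ind_of_le (hs.trans h)]

/-- crossing pairs count for two triples -/
noncomputable def N2 (x0 x1 x2 y0 y1 y2 : ℝ) : ℝ :=
  ind (x0+y0) + ind (x0+y1) + ind (x0+y2) + ind (x1+y0) + ind (x1+y1) + ind (x1+y2) +
  ind (x2+y0) + ind (x2+y1) + ind (x2+y2)

/-- sorted nonneg triple of sum at most 1, all coordinates below 1 -/
structure Tri (x0 x1 x2 : ℝ) : Prop where
  a : 0 ≤ x0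
  b : x0 ≤ x1
  c : x1 ≤ x2
  s : x0 + x1 + x2 ≤ 1
  l : x2 < 1

lemma N2_comm (x0 x1 x2 y0 y1 y2 : ℝ) : N2 x0 x1 x2 y0 y1 y2 = N2 y0 y1 y2 x0 x1 x2 := by
  unfold N2
  rw [add_comm x0 y0, add_comm x0 y1, add_comm x0 y2, add_comm x1 y0, add_comm x1 y1,
    add_comm x1 y2, add_comm x2 y0, add_comm x2 y1, add_comm x2 y2]
  ring

lemma N2_zero {x0 x1 x2 y0 y1 y2 : ℝ} (hx : Tri x0 x1 x2) (hy : Tri y0 y1 y2)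
    (h : x2 + y2 < 1) : N2 x0 x1 x2 y0 y1 y2 = 0 := by
  obtain ⟨a, b, c, s, l⟩ := hx
  obtain ⟨a', b', c', s', l'⟩ := hy
  unfold N2
  rw [ind_of_lt (by linarith), ind_of_lt (by linarith), ind_of_lt (by linarith),
    ind_of_lt (by linarith), ind_of_lt (by linarith), ind_of_lt (by linarith),
    ind_of_lt (by linarith), ind_of_lt (by linarith), ind_of_lt h]
  norm_num

/-- the half case -/
lemma N2_half {x0 x1 x2 y0 y1 y2 : ℝ} (hx : Tri x0 x1 x2) (hy : Tri y0 y1 y2)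
    (h : 1 ≤ x1 + y1) : x0 = 0 ∧ x1 = 1/2 ∧ x2 = 1/2 ∧ y0 = 0 ∧ y1 = 1/2 ∧ y2 = 1/2 := by
  obtain ⟨a, b, c, s, l⟩ := hx
  obtain ⟨a', b', c', s', l'⟩ := hy
  refine ⟨?_, ?_, ?_, ?_, ?_, ?_⟩ <;> linarith

lemma N2_le_four {x0 x1 x2 y0 y1 y2 : ℝ} (hx : Tri x0 x1 x2) (hy : Tri y0 y1 y2) :
    N2 x0 x1 x2 y0 y1 y2 ≤ 4 ∧ (x1 + y1 < 1 → N2 x0 x1 x2 y0 y1 y2 ≤ 3) := by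
  rcases le_or_gt 1 (x1 + y1) with h | h
  · obtain ⟨r1, r2, r3, r4, r5, r6⟩ := N2_half hx hy h
    subst r1 r2 r3 r4 r5 r6
    refine ⟨?_, fun h' => absurd h (not_le.2 h')⟩
    unfold N2 ind; norm_num
  · have key : N2 x0 x1 x2 y0 y1 y2 ≤ 3 := by
      obtain ⟨a, b, c, s, l⟩ := hx
      obtain ⟨a', b', c', s', l'⟩ := hy
      unfold N2
      rw [ind_of_lt (show x0 + y0 < 1 by linarith), ind_of_lt (show x0 + y1 < 1 by linarith),
        ind_of_lt (show x1 + y0 < 1 by linarith), ind_of_lt h]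
      have h1 := ind_le_one (x2 + y2)
      rcases lt_or_ge (x0 + y2) 1 with h2 | h2
      · rcases lt_or_ge (x2 + y0) 1 with h3 | h3
        · rw [ind_of_lt h2, ind_of_lt h3]
          have h4 := ind_le_one (x1 + y2)
          have h5 := ind_le_one (x2 + y1)
          linarith
        · rw [ind_of_lt h2, ind_of_lt (show x1 + y2 < 1 by linarith)]
          have h4 := ind_le_one (x2 + y0)
          have h5 := ind_le_one (x2 + y1)
          linarith
      · rw [ind_of_lt (show x2 + y0 < 1 by linarith), ind_of_lt (show x2 + y1 < 1 by linarith)]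
        have h4 := ind_le_one (x0 + y2)
        have h5 := ind_le_one (x1 + y2)
        linarith
    exact ⟨by linarith, fun _ => key⟩

lemma N2_ge_three {x0 x1 x2 y0 y1 y2 : ℝ} (hx : Tri x0 x1 x2) (hy : Tri y0 y1 y2)
    (h : x1 + y1 < 1) (h3 : ¬ N2 x0 x1 x2 y0 y1 y2 ≤ 2) :
    (1 ≤ x2 + y1 ∧ 1 ≤ x1 + y2) ∨ 1 ≤ x2 + y0 ∨ 1 ≤ x0 + y2 := by
  by_contra hcon
  push Not at hcon
  obtain ⟨p1, p2, p3⟩ := hcon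
  apply h3
  obtain ⟨a, b, c, s, l⟩ := hx
  obtain ⟨a', b', c', s', l'⟩ := hy
  unfold N2
  rw [ind_of_lt (show x0 + y0 < 1 by linarith), ind_of_lt (show x0 + y1 < 1 by linarith),
        ind_of_lt (show x1 + y0 < 1 by linarith), ind_of_lt h, ind_of_lt p2, ind_of_lt p3]
  have h1 := ind_le_one (x2 + y2)
  have h2 := ind_le_one (x1 + y2)
  have h4 := ind_le_one (x2 + y1)
  rcases lt_or_ge (x2 + y1) 1 with h5 | h5
  · rw [ind_of_lt h5]; linarith
  · rw [ind_of_lt (p1 h5)]; linarith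

/-- crossing triples count -/
noncomputable def A3 (x0 x1 x2 y0 y1 y2 z0 z1 z2 : ℝ) : ℝ :=
  ind (x0+y0+z0) + ind (x0+y0+z1) + ind (x0+y0+z2) +
  ind (x0+y1+z0) + ind (x0+y1+z1) + ind (x0+y1+z2) +
  ind (x0+y2+z0) + ind (x0+y2+z1) + ind (x0+y2+z2) +
  ind (x1+y0+z0) + ind (x1+y0+z1) + ind (x1+y0+z2) +
  ind (x1+y1+z0) + ind (x1+y1+z1) + ind (x1+y1+z2) +
  ind (x1+y2+z0) + ind (x1+y2+z1) + ind (x1+y2+z2) +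
  ind (x2+y0+z0) + ind (x2+y0+z1) + ind (x2+y0+z2) +
  ind (x2+y1+z0) + ind (x2+y1+z1) + ind (x2+y1+z2) +
  ind (x2+y2+z0) + ind (x2+y2+z1) + ind (x2+y2+z2)

/-- all cells other than the eight low ones contribute at most 19 -/
lemma A3_le (x0 x1 x2 y0 y1 y2 z0 z1 z2 : ℝ) :
    A3 x0 x1 x2 y0 y1 y2 z0 z1 z2 ≤ 19 +
      (ind (x0+y0+z0) + ind (x1+y1+z1)) + (ind (x0+y0+z1) + ind (x1+y1+z0)) +
      (ind (x0+y1+z0) + ind (x1+y0+z1)) + (ind (x1+y0+z0) + ind (x0+y1+z1)) := by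
  unfold A3
  have := ind_le_one (x0+y0+z2)
  have := ind_le_one (x0+y1+z2)
  have := ind_le_one (x0+y2+z0)
  have := ind_le_one (x0+y2+z1)
  have := ind_le_one (x0+y2+z2)
  have := ind_le_one (x1+y0+z2)
  have := ind_le_one (x1+y1+z2)
  have := ind_le_one (x1+y2+z0)
  have := ind_le_one (x1+y2+z1)
  have := ind_le_one (x1+y2+z2)
  have := ind_le_one (x2+y0+z0)
  have := ind_le_one (x2+y0+z1)
  have := ind_le_one (x2+y0+z2)
  have := ind_le_one (x2+y1+z0)
  have := ind_le_one (x2+y1+z1)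
  have := ind_le_one (x2+y1+z2)
  have := ind_le_one (x2+y2+z0)
  have := ind_le_one (x2+y2+z1)
  have := ind_le_one (x2+y2+z2)
  linarith

lemma ind_pair {s t : ℝ} (h : s + t < 2) : ind s + ind t ≤ 1 := by
  rcases lt_or_ge s 1 with hs | hs
  · rw [ind_of_lt hs]; linarith [ind_le_one t]
  · rw [ind_of_lt (show t < 1 by linarith)]; linarith [ind_le_one s]

/-- if there is a crossing pair then at least four cells are missing -/
lemma A3_le_23 {x0 x1 x2 y0 y1 y2 z0 z1 z2 : ℝ} (hx : Tri x0 x1 x2) (hy : Tri y0 y1 y2)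
    (hz : Tri z0 z1 z2) (h : 1 ≤ x2 + y2 ∨ 1 ≤ x2 + z2 ∨ 1 ≤ y2 + z2) :
    A3 x0 x1 x2 y0 y1 y2 z0 z1 z2 ≤ 23 := by
  have h0 := A3_le x0 x1 x2 y0 y1 y2 z0 z1 z2
  obtain ⟨a, b, c, s, l⟩ := hx
  obtain ⟨a', b', c', s', l'⟩ := hy
  obtain ⟨a'', b'', c'', s'', l''⟩ := hz
  have key : x0 + x1 + (y0 + y1) + (z0 + z1) < 2 := by
    rcases h with h | h | h
    · linarith
    · linarith
    · linarith
  have h1 := ind_pair (show (x0+y0+z0) + (x1+y1+z1) < 2 by linarith)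
  have h2 := ind_pair (show (x0+y0+z1) + (x1+y1+z0) < 2 by linarith)
  have h3 := ind_pair (show (x0+y1+z0) + (x1+y0+z1) < 2 by linarith)
  have h4 := ind_pair (show (x1+y0+z0) + (x0+y1+z1) < 2 by linarith)
  linarith

/-- all three pairs of count 3 -/
lemma A3_le_21 {x0 x1 x2 y0 y1 y2 z0 z1 z2 : ℝ} (hx : Tri x0 x1 x2) (hy : Tri y0 y1 y2)
    (hz : Tri z0 z1 z2) (hxy : x1 + y1 < 1) (hxz : x1 + z1 < 1) (hyz : y1 + z1 < 1)
    (h1 : (1 ≤ x2 + y1 ∧ 1 ≤ x1 + y2) ∨ 1 ≤ x2 + y0 ∨ 1 ≤ x0 + y2)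
    (h2 : (1 ≤ x2 + z1 ∧ 1 ≤ x1 + z2) ∨ 1 ≤ x2 + z0 ∨ 1 ≤ x0 + z2)
    (h3 : (1 ≤ y2 + z1 ∧ 1 ≤ y1 + z2) ∨ 1 ≤ y2 + z0 ∨ 1 ≤ y0 + z2) :
    A3 x0 x1 x2 y0 y1 y2 z0 z1 z2 ≤ 22 := by
  have h0 := A3_le x0 x1 x2 y0 y1 y2 z0 z1 z2
  obtain ⟨a, b, c, s, l⟩ := hx
  obtain ⟨a', b', c', s', l'⟩ := hy
  obtain ⟨a'', b'', c'', s'', l''⟩ := hz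
  have k1 : ¬ (1 ≤ x0 + y1 + z1 ∧ 1 ≤ x1 + y0 + z1) := by
    rintro ⟨u, u'⟩
    rcases h1 with h1 | h1 | h1 <;> rcases h2 with h2 | h2 | h2 <;>
      rcases h3 with h3 | h3 | h3 <;> linarith
  have k2 : ¬ (1 ≤ x0 + y1 + z1 ∧ 1 ≤ x1 + y1 + z0) := by
    rintro ⟨u, u'⟩
    rcases h1 with h1 | h1 | h1 <;> rcases h2 with h2 | h2 | h2 <;>
      rcases h3 with h3 | h3 | h3 <;> linarith
  have k3 : ¬ (1 ≤ x1 + y0 + z1 ∧ 1 ≤ x1 + y1 + z0) := by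
    rintro ⟨u, u'⟩
    rcases h1 with h1 | h1 | h1 <;> rcases h2 with h2 | h2 | h2 <;>
      rcases h3 with h3 | h3 | h3 <;> linarith
  have e1 := ind_le_one (x1+y1+z1)
  have e2 := ind_le_one (x1+y1+z0)
  have e3 := ind_le_one (x1+y0+z1)
  have e4 := ind_le_one (x0+y1+z1)
  rcases lt_or_ge (x0 + y1 + z1) 1 with g1 | g1
  · rcases lt_or_ge (x1 + y0 + z1) 1 with g2 | g2
    · rw [ind_of_lt g1, ind_of_lt g2, ind_of_lt (show x0 + y0 + z0 < 1 by linarith),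
        ind_of_lt (show x0 + y0 + z1 < 1 by linarith), ind_of_lt (show x0 + y1 + z0 < 1 by linarith),
        ind_of_lt (show x1 + y0 + z0 < 1 by linarith)] at h0
      linarith
    · have g3 : x1 + y1 + z0 < 1 := by by_contra hc; exact k3 ⟨g2, not_lt.1 hc⟩
      rw [ind_of_lt g1, ind_of_lt g3, ind_of_lt (show x0 + y0 + z0 < 1 by linarith),
        ind_of_lt (show x0 + y0 + z1 < 1 by linarith), ind_of_lt (show x0 + y1 + z0 < 1 by linarith),
        ind_of_lt (show x1 + y0 + z0 < 1 by linarith)] at h0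
      linarith
  · have g3 : x1 + y1 + z0 < 1 := by by_contra hc; exact k2 ⟨g1, not_lt.1 hc⟩
    have g2 : x1 + y0 + z1 < 1 := by by_contra hc; exact k1 ⟨g1, not_lt.1 hc⟩
    rw [ind_of_lt g2, ind_of_lt g3, ind_of_lt (show x0 + y0 + z0 < 1 by linarith),
        ind_of_lt (show x0 + y0 + z1 < 1 by linarith), ind_of_lt (show x0 + y1 + z0 < 1 by linarith),
        ind_of_lt (show x1 + y0 + z0 < 1 by linarith)] at h0
    linarith

/-- if a half triple is paired with a non-half one, the count is at most two -/
lemma N2_half_le {y0 y1 y2 : ℝ} (hy : Tri y0 y1 y2) (h : y1 < 1/2) :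
    N2 0 (1/2) (1/2) y0 y1 y2 ≤ 2 := by
  obtain ⟨a', b', c', s', l'⟩ := hy
  unfold N2
  rw [ind_of_lt (show 0 + y0 < 1 by linarith), ind_of_lt (show 0 + y1 < 1 by linarith),
    ind_of_lt (show 0 + y2 < 1 by linarith), ind_of_lt (show 1/2 + y0 < 1 by linarith),
    ind_of_lt (show 1/2 + y1 < 1 by linarith)]
  linarith [ind_le_one (1/2 + y2)]

lemma half_case {z0 z1 z2 : ℝ} (hz : Tri z0 z1 z2) :
    z1 < 1/2 ∨ (z0 = 0 ∧ z1 = 1/2 ∧ z2 = 1/2) := by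
  rcases lt_or_ge z1 (1/2) with h | h
  · exact Or.inl h
  · obtain ⟨a', b', c', s', l'⟩ := hz
    refine Or.inr ⟨?_, ?_, ?_⟩ <;> linarith

lemma A3_half : A3 0 (1/2) (1/2) 0 (1/2) (1/2) 0 (1/2) (1/2) ≤ 20 := by
  unfold A3 ind; norm_num

lemma main_ooo {x0 x1 x2 y0 y1 y2 z0 z1 z2 : ℝ} (hx : Tri x0 x1 x2) (hy : Tri y0 y1 y2)
    (hz : Tri z0 z1 z2) :
    2 * A3 x0 x1 x2 y0 y1 y2 z0 z1 z2 +
      (N2 x0 x1 x2 y0 y1 y2 + N2 x0 x1 x2 z0 z1 z2 + N2 y0 y1 y2 z0 z1 z2) ≤ 54 := by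
  have b1 := N2_le_four hx hy
  have b2 := N2_le_four hx hz
  have b3 := N2_le_four hy hz
  by_cases h : 1 ≤ x2 + y2 ∨ 1 ≤ x2 + z2 ∨ 1 ≤ y2 + z2
  · have hA := A3_le_23 hx hy hz h
    rcases lt_or_ge (x1 + y1) 1 with p1 | p1
    · rcases lt_or_ge (x1 + z1) 1 with p2 | p2
      · rcases lt_or_ge (y1 + z1) 1 with p3 | p3
        · have c1 := b1.2 p1
          have c2 := b2.2 p2
          have c3 := b3.2 p3
          by_cases q1 : N2 x0 x1 x2 y0 y1 y2 ≤ 2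
          · linarith
          by_cases q2 : N2 x0 x1 x2 z0 z1 z2 ≤ 2
          · linarith
          by_cases q3 : N2 y0 y1 y2 z0 z1 z2 ≤ 2
          · linarith
          have := A3_le_21 hx hy hz p1 p2 p3 (N2_ge_three hx hy p1 q1) (N2_ge_three hx hz p2 q2)
            (N2_ge_three hy hz p3 q3)
          linarith
        · obtain ⟨r1, r2, r3, r4, r5, r6⟩ := N2_half hy hz p3
          subst r1 r2 r3 r4 r5 r6
          rcases half_case hx with hh | ⟨r1, r2, r3⟩
          · have := N2_half_le hx hh
            rw [N2_comm] at this
            linarith [b3.1]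
          · subst r1 r2 r3
            norm_num at p1
      · obtain ⟨r1, r2, r3, r4, r5, r6⟩ := N2_half hx hz p2
        subst r1 r2 r3 r4 r5 r6
        rcases half_case hy with hh | ⟨r1, r2, r3⟩
        · have h1 := N2_half_le hy hh
          have h2 := h1
          rw [N2_comm] at h2
          linarith [b2.1]
        · subst r1 r2 r3
          norm_num at p1
    · obtain ⟨r1, r2, r3, r4, r5, r6⟩ := N2_half hx hy p1
      subst r1 r2 r3 r4 r5 r6
      rcases half_case hz with hh | ⟨r1, r2, r3⟩
      · have h1 := N2_half_le hz hh
        linarith [b1.1]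
      · subst r1 r2 r3
        have := A3_half
        linarith [b1.1]
  · push Not at h
    obtain ⟨h1, h2, h3⟩ := h
    rw [N2_zero hx hy h1, N2_zero hx hz h2, N2_zero hy hz h3]
    have h0 := A3_le x0 x1 x2 y0 y1 y2 z0 z1 z2
    linarith [ind_le_one (x0+y0+z0), ind_le_one (x0+y0+z1), ind_le_one (x0+y1+z0),
      ind_le_one (x0+y1+z1), ind_le_one (x1+y0+z0), ind_le_one (x1+y0+z1), ind_le_one (x1+y1+z0),
      ind_le_one (x1+y1+z1)]

lemma N2_ge_one {x0 x1 x2 y0 y1 y2 : ℝ} (h : 1 ≤ x2 + y2) : 1 ≤ N2 x0 x1 x2 y0 y1 y2 := by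
  unfold N2
  rw [ind_of_le h]
  have := ind_nonneg
  linarith [this (x0+y0), this (x0+y1), this (x0+y2), this (x1+y0), this (x1+y1), this (x1+y2),
    this (x2+y0), this (x2+y1)]

lemma N2_nonneg (x0 x1 x2 y0 y1 y2 : ℝ) : 0 ≤ N2 x0 x1 x2 y0 y1 y2 := by
  unfold N2
  have := ind_nonneg
  linarith [this (x0+y0), this (x0+y1), this (x0+y2), this (x1+y0), this (x1+y1), this (x1+y2),
    this (x2+y0), this (x2+y1), this (x2+y2)]

lemma main_ooo' {x0 x1 x2 y0 y1 y2 z0 z1 z2 : ℝ} (hx : Tri x0 x1 x2) (hy : Tri y0 y1 y2)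
    (hz : Tri z0 z1 z2) :
    1 ≤ (N2 x0 x1 x2 y0 y1 y2 + N2 x0 x1 x2 z0 z1 z2 + N2 y0 y1 y2 z0 z1 z2) ∨
    (N2 x0 x1 x2 y0 y1 y2 + N2 x0 x1 x2 z0 z1 z2 + N2 y0 y1 y2 z0 z1 z2 = 0 ∧
      (A3 x0 x1 x2 y0 y1 y2 z0 z1 z2 ≤ 26 ∨
      ((x0 = 1/3 ∧ x1 = 1/3 ∧ x2 = 1/3) ∧ (y0 = 1/3 ∧ y1 = 1/3 ∧ y2 = 1/3) ∧
        (z0 = 1/3 ∧ z1 = 1/3 ∧ z2 = 1/3)))) := by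
  have n1 := N2_nonneg x0 x1 x2 y0 y1 y2
  have n2 := N2_nonneg x0 x1 x2 z0 z1 z2
  have n3 := N2_nonneg y0 y1 y2 z0 z1 z2
  rcases lt_or_ge (x2 + y2) 1 with h1 | h1
  swap
  · left; linarith [N2_ge_one (x0 := x0) (x1 := x1) (y0 := y0) (y1 := y1) h1]
  rcases lt_or_ge (x2 + z2) 1 with h2 | h2
  swap
  · left; linarith [N2_ge_one (x0 := x0) (x1 := x1) (y0 := z0) (y1 := z1) h2]
  rcases lt_or_ge (y2 + z2) 1 with h3 | h3
  swap
  · left; linarith [N2_ge_one (x0 := y0) (x1 := y1) (y0 := z0) (y1 := z1) h3]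
  right
  refine ⟨by rw [N2_zero hx hy h1, N2_zero hx hz h2, N2_zero hy hz h3]; norm_num, ?_⟩
  rcases lt_or_ge (x0 + y0 + z0) 1 with h | h
  · left
    have h0 := A3_le x0 x1 x2 y0 y1 y2 z0 z1 z2
    rw [ind_of_lt h] at h0
    linarith [ind_le_one (x0+y0+z1), ind_le_one (x0+y1+z0),
      ind_le_one (x0+y1+z1), ind_le_one (x1+y0+z0), ind_le_one (x1+y0+z1), ind_le_one (x1+y1+z0),
      ind_le_one (x1+y1+z1)]
  · right
    obtain ⟨a, b, c, s, l⟩ := hx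
    obtain ⟨a', b', c', s', l'⟩ := hy
    obtain ⟨a'', b'', c'', s'', l''⟩ := hz
    refine ⟨⟨?_, ?_, ?_⟩, ⟨?_, ?_, ?_⟩, ⟨?_, ?_, ?_⟩⟩ <;> linarith


noncomputable def Qv (v : ℝ) (x : Fin 3 → ℝ) (h : ℝ → ℝ) : ℝ := v * h 0 + ∑ k, h (x k)

noncomputable def Kern (v : ℝ) (x y z : Fin 3 → ℝ) : ℝ :=
  Qv v x (fun a => Qv v y (fun b => Qv v z (fun c => ind (a + b + c))))

open Classical in
noncomputable def sT (x : Fin 3 → ℝ) : ℝ := if ∃ k, 1 ≤ x k then 1 else 0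
open Classical in
noncomputable def dT (x : Fin 3 → ℝ) : ℝ := if ∀ k, x k = 1/3 then 1 else 0

lemma Kern_expand (v : ℝ) (x y z : Fin 3 → ℝ) :
    Kern v x y z = v^2 * ((ind (x 0) + ind (x 1) + ind (x 2)) + (ind (y 0) + ind (y 1) + ind (y 2))
      + (ind (z 0) + ind (z 1) + ind (z 2))) +
      v * (N2 (x 0) (x 1) (x 2) (y 0) (y 1) (y 2) + N2 (x 0) (x 1) (x 2) (z 0) (z 1) (z 2)
        + N2 (y 0) (y 1) (y 2) (z 0) (z 1) (z 2))
      + A3 (x 0) (x 1) (x 2) (y 0) (y 1) (y 2) (z 0) (z 1) (z 2) := by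
  unfold Kern Qv N2 A3
  simp only [Fin.sum_univ_three, zero_add, add_zero]
  rw [ind_of_lt (show (0:ℝ) < 1 by norm_num)]
  ring

lemma Qv_perm (v : ℝ) (x : Fin 3 → ℝ) (h : ℝ → ℝ) (σ : Equiv.Perm (Fin 3)) :
    Qv v (x ∘ σ) h = Qv v x h := by
  unfold Qv
  congr 1
  exact Equiv.sum_comp σ (fun k => h (x k))

lemma sT_perm (x : Fin 3 → ℝ) (σ : Equiv.Perm (Fin 3)) : sT (x ∘ σ) = sT x := by
  unfold sT
  congr 1
  apply propext
  constructor
  · rintro ⟨k, hk⟩; exact ⟨σ k, hk⟩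
  · rintro ⟨k, hk⟩; exact ⟨σ.symm k, by simpa using hk⟩

lemma dT_perm (x : Fin 3 → ℝ) (σ : Equiv.Perm (Fin 3)) : dT (x ∘ σ) = dT x := by
  unfold dT
  congr 1
  apply propext
  constructor
  · intro h k; simpa using h (σ.symm k)
  · intro h k; exact h (σ k)

lemma sT_cases {x : Fin 3 → ℝ} (h0 : ∀ k, 0 ≤ x k) (hs : ∑ k, x k ≤ 1) (h1 : x 0 ≤ x 1)
    (h2 : x 1 ≤ x 2) : (sT x = 1 ∧ x 0 = 0 ∧ x 1 = 0 ∧ x 2 = 1) ∨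
      (sT x = 0 ∧ Tri (x 0) (x 1) (x 2)) := by
  rw [Fin.sum_univ_three] at hs
  have a := h0 0
  have b := h0 1
  have c := h0 2
  unfold sT
  rcases lt_or_ge (x 2) 1 with h | h
  · right
    refine ⟨if_neg ?_, ⟨a, h1, h2, hs, h⟩⟩
    rintro ⟨k, hk⟩
    fin_cases k <;> simp at hk <;> linarith
  · left
    refine ⟨if_pos ⟨2, h⟩, ?_, ?_, ?_⟩ <;> linarith

lemma N2_S {y0 y1 y2 : ℝ} (a : 0 ≤ y0) (b : 0 ≤ y1) (c : 0 ≤ y2) :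
    N2 0 0 1 y0 y1 y2 = 3 + 2 * (ind y0 + ind y1 + ind y2) := by
  unfold N2
  rw [ind_of_le (show 1 ≤ 1 + y0 by linarith), ind_of_le (show 1 ≤ 1 + y1 by linarith),
    ind_of_le (show 1 ≤ 1 + y2 by linarith)]
  simp only [zero_add]
  ring

lemma A3_S1 {y0 y1 y2 z0 z1 z2 : ℝ} (a : 0 ≤ y0) (b : 0 ≤ y1) (c : 0 ≤ y2)
    (a' : 0 ≤ z0) (b' : 0 ≤ z1) (c' : 0 ≤ z2) :
    A3 0 0 1 y0 y1 y2 z0 z1 z2 = 9 + 2 * N2 y0 y1 y2 z0 z1 z2 := by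
  unfold A3 N2
  rw [ind_of_le (show 1 ≤ 1 + y0 + z0 by linarith), ind_of_le (show 1 ≤ 1 + y0 + z1 by linarith),
    ind_of_le (show 1 ≤ 1 + y0 + z2 by linarith), ind_of_le (show 1 ≤ 1 + y1 + z0 by linarith),
    ind_of_le (show 1 ≤ 1 + y1 + z1 by linarith), ind_of_le (show 1 ≤ 1 + y1 + z2 by linarith),
    ind_of_le (show 1 ≤ 1 + y2 + z0 by linarith), ind_of_le (show 1 ≤ 1 + y2 + z1 by linarith),
    ind_of_le (show 1 ≤ 1 + y2 + z2 by linarith)]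
  simp only [zero_add]
  ring

lemma A3_swap12 (x0 x1 x2 y0 y1 y2 z0 z1 z2 : ℝ) :
    A3 x0 x1 x2 y0 y1 y2 z0 z1 z2 = A3 y0 y1 y2 x0 x1 x2 z0 z1 z2 := by
  unfold A3
  rw [add_comm x0 y0, add_comm x0 y1, add_comm x0 y2, add_comm x1 y0, add_comm x1 y1,
    add_comm x1 y2, add_comm x2 y0, add_comm x2 y1, add_comm x2 y2]
  ring

lemma A3_swap13 (x0 x1 x2 y0 y1 y2 z0 z1 z2 : ℝ) :
    A3 x0 x1 x2 y0 y1 y2 z0 z1 z2 = A3 z0 z1 z2 y0 y1 y2 x0 x1 x2 := by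
  have h : ∀ a b c : ℝ, a + b + c = c + b + a := fun a b c => by ring
  unfold A3
  rw [h x0 y0 z0, h x0 y0 z1, h x0 y0 z2, h x0 y1 z0, h x0 y1 z1, h x0 y1 z2, h x0 y2 z0,
    h x0 y2 z1, h x0 y2 z2, h x1 y0 z0, h x1 y0 z1, h x1 y0 z2, h x1 y1 z0, h x1 y1 z1, h x1 y1 z2,
    h x1 y2 z0, h x1 y2 z1, h x1 y2 z2, h x2 y0 z0, h x2 y0 z1, h x2 y0 z2, h x2 y1 z0, h x2 y1 z1,
    h x2 y1 z2, h x2 y2 z0, h x2 y2 z1, h x2 y2 z2]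
  ring

lemma Tri_ind {x0 x1 x2 : ℝ} (h : Tri x0 x1 x2) : ind x0 + ind x1 + ind x2 = 0 := by
  obtain ⟨a, b, c, s, l⟩ := h
  rw [ind_of_lt (show x0 < 1 by linarith), ind_of_lt (show x1 < 1 by linarith), ind_of_lt l]
  norm_num

lemma S_ind : ind 0 + ind 0 + ind 1 = 1 := by unfold ind; norm_num

noncomputable def mx (v : ℝ) : ℝ := max 27 (19 + 15 * v + 3 * v ^ 2)

lemma dT_nonneg (x : Fin 3 → ℝ) : 0 ≤ dT x := by unfold dT; split_ifs <;> norm_num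
lemma sT_nonneg (x : Fin 3 → ℝ) : 0 ≤ sT x := by unfold sT; split_ifs <;> norm_num
lemma sT_le (x : Fin 3 → ℝ) : sT x ≤ 1 := by unfold sT; split_ifs <;> norm_num
lemma dT_le (x : Fin 3 → ℝ) : dT x ≤ 1 := by unfold dT; split_ifs <;> norm_num

lemma kern_sorted {v : ℝ} (hv : 0 ≤ v) {x y z : Fin 3 → ℝ}
    (hx : ∀ k, 0 ≤ x k) (hxs : ∑ k, x k ≤ 1) (hx1 : x 0 ≤ x 1) (hx2 : x 1 ≤ x 2)
    (hy : ∀ k, 0 ≤ y k) (hys : ∑ k, y k ≤ 1) (hy1 : y 0 ≤ y 1) (hy2 : y 1 ≤ y 2)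
    (hz : ∀ k, 0 ≤ z k) (hzs : ∑ k, z k ≤ 1) (hz1 : z 0 ≤ z 1) (hz2 : z 1 ≤ z 2) :
    Kern v x y z ≤ mx v - 1/100 * (1 - sT x * sT y * sT z - dT x * dT y * dT z) := by
  rw [Kern_expand]
  have m1 : (27:ℝ) ≤ mx v := le_max_left _ _
  have m2 : 19 + 15 * v + 3 * v ^ 2 ≤ mx v := le_max_right _ _
  have hD : 0 ≤ dT x * dT y * dT z :=
    mul_nonneg (mul_nonneg (dT_nonneg x) (dT_nonneg y)) (dT_nonneg z)
  rcases sT_cases hx hxs hx1 hx2 with ⟨s1, a1, a2, a3⟩ | ⟨s1, t1⟩ <;>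
  rcases sT_cases hy hys hy1 hy2 with ⟨s2, b1, b2, b3⟩ | ⟨s2, t2⟩ <;>
  rcases sT_cases hz hzs hz1 hz2 with ⟨s3, c1, c2, c3⟩ | ⟨s3, t3⟩
  · rw [s1, s2, s3, a1, a2, a3, b1, b2, b3, c1, c2, c3, S_ind,
      A3_S1 (by norm_num) (by norm_num) (by norm_num) (by norm_num) (by norm_num) (by norm_num),
      N2_S (by norm_num) (by norm_num) (by norm_num), S_ind]
    nlinarith
  · rw [s1, s2, s3, a1, a2, a3, b1, b2, b3, S_ind, Tri_ind t3,
      A3_S1 (by norm_num) (by norm_num) (by norm_num) (hz 0) (hz 1) (hz 2),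
      N2_S (by norm_num) (by norm_num) (by norm_num), N2_S (hz 0) (hz 1) (hz 2), S_ind, Tri_ind t3]
    nlinarith
  · rw [s1, s2, s3, a1, a2, a3, c1, c2, c3, S_ind, Tri_ind t2,
      A3_S1 (hy 0) (hy 1) (hy 2) (by norm_num) (by norm_num) (by norm_num),
      N2_comm (y 0), N2_S (hy 0) (hy 1) (hy 2),
      N2_S (by norm_num) (by norm_num) (by norm_num), S_ind, Tri_ind t2]
    nlinarith
  · have := (N2_le_four t2 t3).1
    rw [s1, s2, s3, a1, a2, a3, S_ind, Tri_ind t2, Tri_ind t3,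
      A3_S1 (hy 0) (hy 1) (hy 2) (hz 0) (hz 1) (hz 2),
      N2_S (hy 0) (hy 1) (hy 2), N2_S (hz 0) (hz 1) (hz 2), Tri_ind t2, Tri_ind t3]
    nlinarith
  · rw [s1, s2, s3, b1, b2, b3, c1, c2, c3, S_ind, Tri_ind t1, A3_swap12,
      A3_S1 (hx 0) (hx 1) (hx 2) (by norm_num) (by norm_num) (by norm_num),
      N2_comm (x 0), N2_S (hx 0) (hx 1) (hx 2),
      N2_S (by norm_num) (by norm_num) (by norm_num), S_ind, Tri_ind t1]
    nlinarith
  · have := (N2_le_four t1 t3).1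
    rw [s1, s2, s3, b1, b2, b3, S_ind, Tri_ind t1, Tri_ind t3, A3_swap12,
      A3_S1 (hx 0) (hx 1) (hx 2) (hz 0) (hz 1) (hz 2), N2_comm (x 0) (x 1) (x 2) 0 0 1,
      N2_S (hx 0) (hx 1) (hx 2), N2_S (hz 0) (hz 1) (hz 2), Tri_ind t1, Tri_ind t3]
    nlinarith
  · have := (N2_le_four t1 t2).1
    rw [s1, s2, s3, c1, c2, c3, S_ind, Tri_ind t1, Tri_ind t2, A3_swap13,
      A3_S1 (hy 0) (hy 1) (hy 2) (hx 0) (hx 1) (hx 2), N2_comm (x 0) (x 1) (x 2) 0 0 1,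
      N2_comm (y 0) (y 1) (y 2) 0 0 1, N2_comm (y 0) (y 1) (y 2),
      N2_S (hx 0) (hx 1) (hx 2), N2_S (hy 0) (hy 1) (hy 2), Tri_ind t1, Tri_ind t2]
    nlinarith
  · have k1 := main_ooo t1 t2 t3
    have k2 := main_ooo' t1 t2 t3
    have l1 := (N2_le_four t1 t2).1
    have l2 := (N2_le_four t1 t3).1
    have l3 := (N2_le_four t2 t3).1
    rw [s1, s2, s3, Tri_ind t1, Tri_ind t2, Tri_ind t3]
    set N := N2 (x 0) (x 1) (x 2) (y 0) (y 1) (y 2) + N2 (x 0) (x 1) (x 2) (z 0) (z 1) (z 2)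
        + N2 (y 0) (y 1) (y 2) (z 0) (z 1) (z 2) with hN
    set A := A3 (x 0) (x 1) (x 2) (y 0) (y 1) (y 2) (z 0) (z 1) (z 2)
    have hN12 : N ≤ 12 := by linarith
    rcases k2 with k2 | ⟨k2, k3 | ⟨⟨p1, p2, p3⟩, ⟨q1, q2, q3⟩, r1, r2, r3⟩⟩
    · rcases le_or_gt v (49/100) with hv' | hv'
      · nlinarith
      · nlinarith
    · rw [k2]; linarith
    · have e1 : dT x = 1 := if_pos (by intro k; fin_cases k <;> assumption)
      have e2 : dT y = 1 := if_pos (by intro k; fin_cases k <;> assumption)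
      have e3 : dT z = 1 := if_pos (by intro k; fin_cases k <;> assumption)
      rw [e1, e2, e3, k2]
      linarith

lemma kern_le {v : ℝ} (hv : 0 ≤ v) {x y z : Fin 3 → ℝ}
    (hx : ∀ k, 0 ≤ x k) (hxs : ∑ k, x k ≤ 1)
    (hy : ∀ k, 0 ≤ y k) (hys : ∑ k, y k ≤ 1)
    (hz : ∀ k, 0 ≤ z k) (hzs : ∑ k, z k ≤ 1) :
    Kern v x y z ≤ mx v - 1/100 * (1 - sT x * sT y * sT z - dT x * dT y * dT z) := by
  have key : Kern v (x ∘ Tuple.sort x) (y ∘ Tuple.sort y) (z ∘ Tuple.sort z) = Kern v x y z := by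
    unfold Kern
    simp only [Qv_perm]
  have mono : ∀ x : Fin 3 → ℝ, (x ∘ Tuple.sort x) 0 ≤ (x ∘ Tuple.sort x) 1 ∧
      (x ∘ Tuple.sort x) 1 ≤ (x ∘ Tuple.sort x) 2 := fun x =>
    ⟨Tuple.monotone_sort x (by decide), Tuple.monotone_sort x (by decide)⟩
  have sums : ∀ x : Fin 3 → ℝ, ∑ k, (x ∘ Tuple.sort x) k = ∑ k, x k := fun x =>
    Equiv.sum_comp (Tuple.sort x) x
  have := kern_sorted hv (x := x ∘ Tuple.sort x) (y := y ∘ Tuple.sort y) (z := z ∘ Tuple.sort z)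
    (fun k => hx _) (by rw [sums]; exact hxs) (mono x).1 (mono x).2
    (fun k => hy _) (by rw [sums]; exact hys) (mono y).1 (mono y).2
    (fun k => hz _) (by rw [sums]; exact hzs) (mono z).1 (mono z).2
  rwa [key, sT_perm, sT_perm, sT_perm, dT_perm, dT_perm, dT_perm] at this


lemma Qv_mono {v : ℝ} (hv : 0 ≤ v) (x : Fin 3 → ℝ) {h g : ℝ → ℝ} (h0 : h 0 ≤ g 0)
    (hk : ∀ k, h (x k) ≤ g (x k)) : Qv v x h ≤ Qv v x g := by
  unfold Qv
  exact add_le_add (mul_le_mul_of_nonneg_left h0 hv) (Finset.sum_le_sum fun k _ => hk k)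

lemma Qv_sum {J : Type*} [Fintype J] (v : ℝ) (x : Fin 3 → ℝ) (ζ : J → ℝ) (f : J → ℝ → ℝ) :
    Qv v x (fun a => ∑ j, ζ j * f j a) = ∑ j, ζ j * Qv v x (f j) := by
  unfold Qv
  rw [Finset.sum_comm, Finset.mul_sum, ← Finset.sum_add_distrib]
  refine Finset.sum_congr rfl fun j _ => ?_
  rw [← Finset.mul_sum]
  ring

lemma dominate {J V : Type*} [Fintype J] [Fintype V] [DecidableEq V] (w : V → ℝ)
    (hw0 : ∀ a, 0 ≤ w a) (t : J → Fin 3 → V) (ζ : J → ℝ) (M v : ℝ)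
    (hM : ∑ j, ζ j = M) (hv : M * v = Fintype.card V - 3 * M)
    (hload : ∀ a, 0 < w a → 1 ≤ ∑ j, ζ j * ∑ k, (if t j k = a then (1:ℝ) else 0))
    (h : ℝ → ℝ) (hh : ∀ x, 0 ≤ x → h 0 ≤ h x) :
    ∑ a, h (w a) ≤ ∑ j, ζ j * Qv v (fun k => w (t j k)) h := by
  set g : V → ℝ := fun a => h (w a) - h 0 with hg
  have e1 : ∑ j, ζ j * Qv v (fun k => w (t j k)) h =
      Fintype.card V * h 0 + ∑ j, ζ j * ∑ k, g (t j k) := by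
    have : ∀ j, ζ j * Qv v (fun k => w (t j k)) h =
        ζ j * (v * h 0 + 3 * h 0) + ζ j * ∑ k, g (t j k) := by
      intro j
      unfold Qv
      simp only [hg, Finset.sum_sub_distrib, Finset.sum_const, Finset.card_univ, Fintype.card_fin,
        nsmul_eq_mul]
      push_cast
      ring
    simp only [this]
    rw [Finset.sum_add_distrib, ← Finset.sum_mul, hM]
    linear_combination (h 0) * hv
  have e2 : ∑ j, ζ j * ∑ k, g (t j k) =
      ∑ a, (∑ j, ζ j * ∑ k, (if t j k = a then (1:ℝ) else 0)) * g a := by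
    simp only [Finset.sum_mul]
    rw [Finset.sum_comm]
    refine Finset.sum_congr rfl fun j _ => ?_
    simp only [mul_assoc]
    rw [← Finset.mul_sum]
    congr 1
    simp only [Finset.sum_mul]
    rw [Finset.sum_comm]
    refine Finset.sum_congr rfl fun k _ => ?_
    simp
  have e3 : ∑ a, h (w a) = Fintype.card V * h 0 + ∑ a, g a := by
    simp only [hg, Finset.sum_sub_distrib, Finset.sum_const, Finset.card_univ, nsmul_eq_mul]
    ring
  rw [e1, e2, e3]
  gcongr with a _
  rcases (hw0 a).eq_or_lt with h0 | h0
  · simp [hg, ← h0]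
  · have h1 := hload a h0
    have h2 : 0 ≤ g a := by simpa [hg] using hh (w a) (hw0 a)
    nlinarith

lemma count_core {J V : Type*} [Fintype J] [Fintype V] [DecidableEq V] (w : V → ℝ)
    (hw0 : ∀ a, 0 ≤ w a) (t : J → Fin 3 → V) (ζ : J → ℝ) (hζ : ∀ j, 0 ≤ ζ j) (M v : ℝ)
    (hM : ∑ j, ζ j = M) (hv : M * v = Fintype.card V - 3 * M) (hv0 : 0 ≤ v)
    (hload : ∀ a, 0 < w a → 1 ≤ ∑ j, ζ j * ∑ k, (if t j k = a then (1:ℝ) else 0))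
    (ht : ∀ j, ζ j ≠ 0 → ∑ k, w (t j k) ≤ 1) :
    ∑ a, ∑ b, ∑ c, ind (w a + w b + w c) ≤ M ^ 3 * mx v - 1/100 *
      (M ^ 3 - (∑ j, ζ j * sT (fun k => w (t j k))) ^ 3
        - (∑ j, ζ j * dT (fun k => w (t j k))) ^ 3) := by
  have D := dominate w hw0 t ζ M v hM hv hload
  have Qm : ∀ j (h g : ℝ → ℝ), (∀ x, h x ≤ g x) →
      ζ j * Qv v (fun k => w (t j k)) h ≤ ζ j * Qv v (fun k => w (t j k)) g := by
    intro j h g hg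
    exact mul_le_mul_of_nonneg_left (Qv_mono hv0 _ (hg _) (fun k => hg _)) (hζ j)
  have s1 : ∑ a, ∑ b, ∑ c, ind (w a + w b + w c) ≤
      ∑ j, ζ j * Qv v (fun k => w (t j k)) (fun x => ∑ b, ∑ c, ind (x + w b + w c)) := by
    refine D (fun x => ∑ b, ∑ c, ind (x + w b + w c)) ?_
    intro x hx
    exact Finset.sum_le_sum fun b _ => Finset.sum_le_sum fun c _ => ind_mono (by linarith)
  have s2 : ∀ x, ∑ b, ∑ c, ind (x + w b + w c) ≤
      ∑ j, ζ j * Qv v (fun k => w (t j k)) (fun y => ∑ c, ind (x + y + w c)) := by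
    intro x
    refine D (fun y => ∑ c, ind (x + y + w c)) ?_
    intro y hy
    exact Finset.sum_le_sum fun c _ => ind_mono (by linarith)
  have s3 : ∀ x y, ∑ c, ind (x + y + w c) ≤
      ∑ j, ζ j * Qv v (fun k => w (t j k)) (fun z => ind (x + y + z)) := by
    intro x y
    refine D (fun z => ind (x + y + z)) ?_
    intro z hz
    exact ind_mono (by linarith)
  have s4 : ∑ a, ∑ b, ∑ c, ind (w a + w b + w c) ≤
      ∑ j₁, ∑ j₂, ∑ j₃, ζ j₁ * ζ j₂ * ζ j₃ * Kern v (fun k => w (t j₁ k)) (fun k => w (t j₂ k))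
        (fun k => w (t j₃ k)) := by
    calc _ ≤ _ := s1
      _ ≤ ∑ j₁, ζ j₁ * Qv v (fun k => w (t j₁ k)) (fun x => ∑ j₂, ζ j₂ *
            Qv v (fun k => w (t j₂ k)) (fun y => ∑ j₃, ζ j₃ *
              Qv v (fun k => w (t j₃ k)) (fun z => ind (x + y + z)))) := by
          refine Finset.sum_le_sum fun j₁ _ => Qm j₁ _ _ fun x => (s2 x).trans ?_
          exact Finset.sum_le_sum fun j₂ _ => Qm j₂ _ _ fun y => s3 x y
      _ = _ := by
          refine Finset.sum_congr rfl fun j₁ _ => ?_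
          rw [Qv_sum, Finset.mul_sum]
          refine Finset.sum_congr rfl fun j₂ _ => ?_
          have : ∀ x, Qv v (fun k => w (t j₂ k)) (fun y => ∑ j₃, ζ j₃ *
              Qv v (fun k => w (t j₃ k)) (fun z => ind (x + y + z))) =
              ∑ j₃, ζ j₃ * Qv v (fun k => w (t j₂ k)) (fun y =>
                Qv v (fun k => w (t j₃ k)) (fun z => ind (x + y + z))) := by
            intro x
            rw [Qv_sum]
          simp only [this]
          rw [Qv_sum, Finset.mul_sum, Finset.mul_sum]
          refine Finset.sum_congr rfl fun j₃ _ => ?_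
          unfold Kern
          ring
  refine s4.trans ?_
  set s : J → ℝ := fun j => sT (fun k => w (t j k)) with hs
  set d : J → ℝ := fun j => dT (fun k => w (t j k)) with hd
  have s5 : ∀ j₁ j₂ j₃, ζ j₁ * ζ j₂ * ζ j₃ * Kern v (fun k => w (t j₁ k)) (fun k => w (t j₂ k))
        (fun k => w (t j₃ k)) ≤ ζ j₁ * ζ j₂ * ζ j₃ * (mx v - 1/100 *
          (1 - s j₁ * s j₂ * s j₃ - d j₁ * d j₂ * d j₃)) := by
    intro j₁ j₂ j₃
    by_cases h1 : ζ j₁ = 0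
    · simp [h1]
    by_cases h2 : ζ j₂ = 0
    · simp [h2]
    by_cases h3 : ζ j₃ = 0
    · simp [h3]
    refine mul_le_mul_of_nonneg_left ?_ (mul_nonneg (mul_nonneg (hζ _) (hζ _)) (hζ _))
    exact kern_le hv0 (fun k => hw0 _) (ht _ h1) (fun k => hw0 _) (ht _ h2) (fun k => hw0 _) (ht _ h3)
  refine (Finset.sum_le_sum fun j₁ _ => Finset.sum_le_sum fun j₂ _ =>
    Finset.sum_le_sum fun j₃ _ => s5 j₁ j₂ j₃).trans (le_of_eq ?_)
  have cube : ∀ f : J → ℝ, (∑ j, f j) ^ 3 = ∑ j₁, ∑ j₂, ∑ j₃, f j₁ * f j₂ * f j₃ := by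
    intro f
    rw [pow_three', Finset.sum_mul_sum, Finset.sum_mul]
    refine Finset.sum_congr rfl fun j₁ _ => ?_
    rw [Finset.sum_mul]
    refine Finset.sum_congr rfl fun j₂ _ => ?_
    rw [Finset.mul_sum]
  rw [← hM, cube, cube, cube]
  simp only [Finset.mul_sum, Finset.sum_mul, ← Finset.sum_sub_distrib]
  refine Finset.sum_congr rfl fun j₁ _ => Finset.sum_congr rfl fun j₂ _ =>
    Finset.sum_congr rfl fun j₃ _ => ?_
  ring


/-- multiplicity of `a` in the tuple `e` -/
def cnt {V : Type*} [DecidableEq V] (e : Fin 3 → V) (a : V) : ℝ :=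
  ∑ k, (if e k = a then (1:ℝ) else 0)

def loadz {I V : Type*} [Fintype I] [Fintype V] [DecidableEq V]
    (z : I → (Fin 3 → V) → ℝ) (a : V) : ℝ := ∑ i, ∑ e, z i e * cnt e a

lemma cnt_nonneg {V : Type*} [DecidableEq V] (e : Fin 3 → V) (a : V) : 0 ≤ cnt e a :=
  Finset.sum_nonneg fun k _ => by split_ifs <;> norm_num

lemma cnt_le {V : Type*} [DecidableEq V] (e : Fin 3 → V) (a : V) : cnt e a ≤ 3 := by
  unfold cnt
  rw [Fin.sum_univ_three]
  have : ∀ k, (if e k = a then (1:ℝ) else 0) ≤ 1 := fun k => by split_ifs <;> norm_num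
  linarith [this 0, this 1, this 2]

lemma sum_cnt {V : Type*} [Fintype V] [DecidableEq V] (e : Fin 3 → V) (w : V → ℝ) :
    ∑ a, w a * cnt e a = ∑ k, w (e k) := by
  unfold cnt
  simp only [Finset.mul_sum]
  rw [Finset.sum_comm]
  refine Finset.sum_congr rfl fun k _ => ?_
  simp

lemma pos_sq (s h : ℝ) : (max (s + h) 0) ^ 2 ≤ (max s 0) ^ 2 + 2 * (max s 0) * h + h ^ 2 := by
  have : (max s 0) ^ 2 + 2 * (max s 0) * h + h ^ 2 = (max s 0 + h) ^ 2 := by ring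
  rw [this]
  rcases le_total (s + h) 0 with h1 | h1
  · rw [max_eq_right h1]; nlinarith [sq_nonneg (max s 0 + h)]
  · rw [max_eq_left h1]
    have := le_max_left s 0
    nlinarith

theorem frac_opt {I V : Type*} [Fintype I] [DecidableEq I] [Fintype V] [DecidableEq V] (β : ℝ)
    (G : I → Finset (Fin 3 → V)) (hG : ∀ i, (G i).Nonempty) :
    ∃ z : I → (Fin 3 → V) → ℝ, (∀ i e, 0 ≤ z i e) ∧ (∀ i, ∑ e, z i e = 1) ∧
      (∀ i e, e ∉ G i → z i e = 0) ∧
      ∀ i e e', z i e ≠ 0 → e' ∈ G i →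
        ∑ k, max (loadz z (e k) - β) 0 ≤ ∑ k, max (loadz z (e' k) - β) 0 := by
  set X : Set (I → (Fin 3 → V) → ℝ) := {z | (∀ i e, 0 ≤ z i e) ∧ (∀ i, ∑ e, z i e = 1) ∧
      (∀ i e, e ∉ G i → z i e = 0)} with hX
  have hXc : IsCompact X := by
    have hbox : IsCompact (Set.pi Set.univ (fun _ : I => Set.pi Set.univ
        (fun _ : (Fin 3 → V) => Set.Icc (0:ℝ) 1))) :=
      isCompact_univ_pi fun _ => isCompact_univ_pi fun _ => isCompact_Icc
    refine hbox.of_isClosed_subset ?_ ?_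
    · have h1 : IsClosed {z : I → (Fin 3 → V) → ℝ | ∀ i e, 0 ≤ z i e} := by
        simp only [Set.ofPred_forall]
        exact isClosed_iInter fun i => isClosed_iInter fun e =>
          isClosed_le continuous_const (by fun_prop)
      have h2 : IsClosed {z : I → (Fin 3 → V) → ℝ | ∀ i, ∑ e, z i e = 1} := by
        simp only [Set.ofPred_forall]
        exact isClosed_iInter fun i => isClosed_eq (by fun_prop) continuous_const
      have h3 : IsClosed {z : I → (Fin 3 → V) → ℝ | ∀ i e, e ∉ G i → z i e = 0} := by
        simp only [Set.ofPred_forall]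
        exact isClosed_iInter fun i => isClosed_iInter fun e => isClosed_iInter fun _ =>
          isClosed_eq (by fun_prop) continuous_const
      exact h1.inter (h2.inter h3)
    · rintro z ⟨h1, h2, -⟩ i - e -
      refine ⟨h1 i e, ?_⟩
      rw [← h2 i]
      exact Finset.single_le_sum (fun e _ => h1 i e) (Finset.mem_univ e)
  have hXn : X.Nonempty := by
    choose e he using hG
    refine ⟨fun i e' => if e' = e i then 1 else 0, ?_, ?_, ?_⟩
    · intro i e'
      dsimp only
      split_ifs <;> norm_num
    · intro i; simp
    · intro i e' he'
      dsimp only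
      rw [if_neg]
      rintro rfl
      exact he' (he i)
  set Φ : (I → (Fin 3 → V) → ℝ) → ℝ := fun z => ∑ a, (max (loadz z a - β) 0) ^ 2 with hΦ
  have hΦc : Continuous Φ := by
    simp only [hΦ, loadz]
    fun_prop
  obtain ⟨z, hz, hmin⟩ := hXc.exists_isMinOn hXn hΦc.continuousOn
  refine ⟨z, hz.1, hz.2.1, hz.2.2, ?_⟩
  intro i e e' he he'
  by_cases hee : e = e'
  · rw [hee]
  obtain ⟨z1, z2, z3⟩ := hz
  have hpos : 0 < z i e := lt_of_le_of_ne (z1 i e) (Ne.symm he)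
  have heG : e ∈ G i := by by_contra h; exact he (z3 i e h)
  set w : V → ℝ := fun a => max (loadz z a - β) 0 with hw
  have key : ∀ τ : ℝ, 0 < τ → τ ≤ z i e →
      0 ≤ 2 * (∑ k, w (e' k) - ∑ k, w (e k)) + τ * (9 * Fintype.card V) := by
    intro τ h0 h1
    set δ : (Fin 3 → V) → ℝ := fun f => (if f = e' then 1 else 0) - (if f = e then 1 else 0) with hδ
    set z' : I → (Fin 3 → V) → ℝ := fun i' f => z i' f + if i' = i then τ * δ f else 0 with hz'
    have hδs : ∑ f, δ f = 0 := by simp [hδ]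
    have hz'X : z' ∈ X := by
      refine ⟨?_, ?_, ?_⟩
      · intro i' f
        simp only [hz', hδ]
        by_cases hi : i' = i
        · subst hi
          rw [if_pos rfl]
          by_cases hf : f = e
          · subst hf
            rw [if_neg hee, if_pos rfl]
            linarith
          · rw [if_neg hf]
            have := z1 i' f
            split_ifs <;> nlinarith
        · rw [if_neg hi]
          linarith [z1 i' f]
      · intro i'
        simp only [hz', Finset.sum_add_distrib, z2 i']
        by_cases hi : i' = i
        · simp only [hi, if_true]
          rw [← Finset.mul_sum, hδs]
          ring
        · simp [hi]
      · intro i' f hf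
        simp only [hz', hδ]
        by_cases hi : i' = i
        · subst hi
          have n1 : f ≠ e := by rintro rfl; exact hf heG
          have n2 : f ≠ e' := by rintro rfl; exact hf he'
          simp [n1, n2, z3 i' f hf]
        · simp [hi, z3 i' f hf]
    have hload : ∀ a, loadz z' a = loadz z a + τ * (cnt e' a - cnt e a) := by
      intro a
      simp only [loadz, hz', add_mul, Finset.sum_add_distrib]
      congr 1
      rw [Finset.sum_eq_single i]
      · simp only [if_true, hδ, sub_mul, mul_sub, Finset.sum_sub_distrib]
        simp
      · intro i' _ hi
        simp [hi]
      · simp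
    have h2 : Φ z ≤ Φ z' := hmin hz'X
    have h3 : Φ z' ≤ ∑ a, (w a ^ 2 + 2 * τ * (w a * cnt e' a - w a * cnt e a) + τ ^ 2 * 9) := by
      refine Finset.sum_le_sum fun a _ => ?_
      rw [hload a, show loadz z a + τ * (cnt e' a - cnt e a) - β =
        (loadz z a - β) + τ * (cnt e' a - cnt e a) by ring]
      refine (pos_sq _ _).trans ?_
      have b1 := cnt_nonneg e a
      have b2 := cnt_nonneg e' a
      have b3 := cnt_le e a
      have b4 := cnt_le e' a
      have b5 : (cnt e' a - cnt e a) ^ 2 ≤ 9 := by nlinarith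
      have b6 : 0 ≤ τ ^ 2 := sq_nonneg τ
      have b7 := mul_le_mul_of_nonneg_left b5 b6
      simp only [hw]
      nlinarith
    rw [Finset.sum_add_distrib, Finset.sum_add_distrib, ← Finset.mul_sum, Finset.sum_sub_distrib,
      sum_cnt, sum_cnt, Finset.sum_const, Finset.card_univ, nsmul_eq_mul] at h3
    have h4 : 0 ≤ τ * (2 * (∑ k, w (e' k) - ∑ k, w (e k)) + τ * (9 * Fintype.card V)) := by
      have : Φ z = ∑ a, w a ^ 2 := rfl
      nlinarith
    exact nonneg_of_mul_nonneg_right h4 h0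
  by_contra hcon
  push Not at hcon
  change ∑ k, w (e' k) < ∑ k, w (e k) at hcon
  set Δ := ∑ k, w (e k) - ∑ k, w (e' k) with hΔ
  have hΔ0 : 0 < Δ := by linarith
  set C : ℝ := 9 * Fintype.card V + 1 with hC
  have hC0 : 0 < C := by positivity
  have k1 := key (min (z i e) (Δ / C)) (lt_min hpos (div_pos hΔ0 hC0)) (min_le_left _ _)
  have k2 : min (z i e) (Δ / C) * (9 * Fintype.card V) ≤ (Δ / C) * C :=
    mul_le_mul (min_le_right _ _) (by linarith) (by positivity) (by positivity)
  rw [div_mul_cancel₀ _ hC0.ne'] at k2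
  linarith

theorem dual_struct {I V : Type*} [Fintype I] [DecidableEq I] [Fintype V] [DecidableEq V] (β : ℝ)
    (hβ : 0 < β) (G : I → Finset (Fin 3 → V)) (z : I → (Fin 3 → V) → ℝ)
    (z1 : ∀ i e, 0 ≤ z i e) (z2 : ∀ i, ∑ e, z i e = 1) (z3 : ∀ i e, e ∉ G i → z i e = 0)
    (z4 : ∀ i e e', z i e ≠ 0 → e' ∈ G i →
        ∑ k, max (loadz z (e k) - β) 0 ≤ ∑ k, max (loadz z (e' k) - β) 0)
    (hbig : ∃ a, β < loadz z a) :
    ∃ w : V → ℝ, (∀ a, 0 ≤ w a) ∧ (∀ a, 0 < w a → β ≤ loadz z a) ∧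
      (∀ i e, z i e ≠ 0 → ∑ k, w (e k) ≤ 1) ∧ (∃ i, ∀ e ∈ G i, 1 ≤ ∑ k, w (e k)) ∧
      (∀ i e, z i e ≠ 0 → 1 ≤ ∑ k, w (e k) → ∀ e' ∈ G i, 1 ≤ ∑ k, w (e' k)) := by
  obtain ⟨a, ha⟩ := hbig
  set w : V → ℝ := fun a => max (loadz z a - β) 0 with hw
  have hw0 : ∀ a, 0 ≤ w a := fun a => le_max_right _ _
  have hzG : ∀ i e, z i e ≠ 0 → e ∈ G i := fun i e h => by by_contra h'; exact h (z3 i e h')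
  have hne : ∀ i, ∃ e, z i e ≠ 0 := by
    intro i
    by_contra h
    push Not at h
    have := z2 i
    simp [h] at this
  choose E hE using hne
  have hwa : 0 < w a := lt_max_of_lt_left (by linarith)
  obtain ⟨i1, e1, he1, hw1⟩ : ∃ i e, z i e ≠ 0 ∧ 0 < ∑ k, w (e k) := by
    by_contra h
    push Not at h
    have : loadz z a = 0 := by
      unfold loadz
      refine Finset.sum_eq_zero fun i _ => Finset.sum_eq_zero fun e _ => ?_
      by_cases hz : z i e = 0
      · rw [hz, zero_mul]
      · have h1 := h i e hz
        have h2 : cnt e a = 0 := by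
          unfold cnt
          refine Finset.sum_eq_zero fun k _ => ?_
          rw [if_neg]
          intro hk
          have := Finset.single_le_sum (f := fun k => w (e k)) (fun k _ => hw0 (e k))
            (Finset.mem_univ k)
          rw [hk] at this
          linarith
        rw [h2, mul_zero]
    linarith
  have : Nonempty I := ⟨i1⟩
  obtain ⟨i0, hi0⟩ := Finite.exists_max (fun i => ∑ k, w (E i k))
  set Y := ∑ k, w (E i0 k) with hY
  have heq : ∀ i e, z i e ≠ 0 → ∑ k, w (e k) = ∑ k, w (E i k) := fun i e h =>
    le_antisymm (z4 i e _ h (hzG _ _ (hE i))) (z4 i _ e (hE i) (hzG _ _ h))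
  have hY0 : 0 < Y := by
    have := hi0 i1
    rw [← heq i1 e1 he1] at this
    linarith
  have hsum : ∀ e : Fin 3 → V, ∑ k, w (e k) / Y = (∑ k, w (e k)) / Y := fun e => by
    rw [Finset.sum_div]
  refine ⟨fun a => w a / Y, fun a => div_nonneg (hw0 a) hY0.le, ?_, ?_, ⟨i0, ?_⟩, ?_⟩
  · intro b hb
    have : 0 < w b := by
      by_contra h
      have h' : w b = 0 := le_antisymm (not_lt.1 h) (hw0 b)
      simp [h'] at hb
    by_contra h
    push Not at h
    have h2 : w b = 0 := max_eq_right (by linarith)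
    linarith
  · intro i e h
    dsimp only
    rw [hsum, div_le_one hY0, heq i e h]
    exact hi0 i
  · intro e he
    dsimp only
    rw [hsum, one_le_div hY0]
    exact z4 i0 _ e (hE i0) he
  · intro i e h h1 e' he'
    dsimp only at h1 ⊢
    rw [hsum, one_le_div hY0] at h1 ⊢
    exact h1.trans (z4 i e e' h he')


theorem round_lem {I V : Type*} [Fintype I] [DecidableEq I] [Fintype V] [DecidableEq V] (β : ℝ)
    (G : I → Finset (Fin 3 → V)) (z : I → (Fin 3 → V) → ℝ)
    (z1 : ∀ i e, 0 ≤ z i e) (z2 : ∀ i, ∑ e, z i e = 1) (z3 : ∀ i e, e ∉ G i → z i e = 0)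
    (hβ : ∀ a, loadz z a ≤ β) :
    ∃ f : I → Fin 3 → V, (∀ i, f i ∈ G i) ∧
      ∀ a, (((Finset.univ : Finset (I × Fin 3)).filter (fun p => f p.1 p.2 = a)).card : ℝ) ≤
        β + 3 * (Fintype.card (Finset (Fin 3 → V)) * Fintype.card (Fin 3 → V)) := by
  classical
  set Y : Finset (Fin 3 → V) → (Fin 3 → V) → ℝ :=
    fun g e => ∑ i ∈ Finset.univ.filter (fun i => G i = g), z i e with hY
  set cap : Finset (Fin 3 → V) → (Fin 3 → V) → ℕ := fun g e => ⌈Y g e⌉₊ with hcap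
  have hemb : ∀ g, ∃ φ : {i // G i = g} → Σ e : Fin 3 → V, Fin (cap g e), Function.Injective φ := by
    intro g
    have : Fintype.card {i // G i = g} ≤ Fintype.card (Σ e : Fin 3 → V, Fin (cap g e)) := by
      rw [Fintype.card_sigma, Fintype.card_subtype]
      simp only [Fintype.card_fin]
      have h1 : ∑ e, Y g e = ((Finset.univ.filter (fun i => G i = g)).card : ℝ) := by
        simp only [hY]
        rw [Finset.sum_comm]
        simp [z2]
      have h2 : ∑ e, Y g e ≤ ∑ e, (cap g e : ℝ) := Finset.sum_le_sum fun e _ => Nat.le_ceil _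
      rw [h1] at h2
      exact_mod_cast h2
    obtain ⟨φ⟩ := Function.Embedding.nonempty_of_card_le this
    exact ⟨φ, φ.injective⟩
  choose φ hφ using hemb
  set f : I → Fin 3 → V := fun i => (φ (G i) ⟨i, rfl⟩).1 with hf
  have hfib : ∀ g e, (Finset.univ.filter (fun i => G i = g ∧ f i = e)).card ≤ cap g e := by
    intro g e
    have : Fintype.card {i // G i = g ∧ f i = e} ≤ Fintype.card (Fin (cap g e)) := by
      have key : ∀ i : {i // G i = g ∧ f i = e}, (φ g ⟨i.1, i.2.1⟩).1 = e := by
        rintro ⟨i, rfl, h2⟩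
        exact h2
      refine Fintype.card_le_of_injective
        (fun i => Fin.cast (by rw [key i]) (φ g ⟨i.1, i.2.1⟩).2) ?_
      intro i j hij
      have h3 : φ g ⟨i.1, i.2.1⟩ = φ g ⟨j.1, j.2.1⟩ := by
        have a1 := key i
        have a2 := key j
        have a3 := congrArg Fin.val hij
        simp only [Fin.val_cast] at a3
        refine Sigma.ext (a1.trans a2.symm) ?_
        rw [Fin.heq_ext_iff (by rw [a1, a2])]
        exact a3
      have := hφ g h3
      exact Subtype.ext (by simpa using this)
    rw [Fintype.card_subtype, Fintype.card_fin] at this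
    exact this
  refine ⟨f, ?_, ?_⟩
  · intro i
    by_contra hni
    have h1 : 0 < cap (G i) (f i) := Fin.pos (φ (G i) ⟨i, rfl⟩).2
    have h2 : 0 < Y (G i) (f i) := Nat.ceil_pos.1 h1
    have h3 : Y (G i) (f i) = 0 := by
      refine Finset.sum_eq_zero fun j hj => ?_
      rw [Finset.mem_filter] at hj
      exact z3 _ _ (by rw [hj.2]; exact hni)
    linarith
  · intro a
    have e1 : (((Finset.univ : Finset (I × Fin 3)).filter (fun p => f p.1 p.2 = a)).card : ℝ)
        = ∑ i, cnt (f i) a := by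
      rw [Finset.card_filter]
      push_cast
      rw [Fintype.sum_prod_type]
      rfl
    have e2 : ∑ i, cnt (f i) a = ∑ g : Finset (Fin 3 → V), ∑ e : Fin 3 → V,
        ((Finset.univ.filter (fun i => G i = g ∧ f i = e)).card : ℝ) * cnt e a := by
      have : ∀ i, cnt (f i) a = ∑ g : Finset (Fin 3 → V), ∑ e : Fin 3 → V,
          (if G i = g ∧ f i = e then (1:ℝ) else 0) * cnt e a := by
        intro i
        rw [Finset.sum_eq_single (G i), Finset.sum_eq_single (f i)]
        · simp
        · intro b _ hb
          rw [if_neg (fun h => hb h.2.symm), zero_mul]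
        · simp
        · intro b _ hb
          refine Finset.sum_eq_zero fun e _ => ?_
          rw [if_neg (fun h => hb h.1.symm), zero_mul]
        · simp
      simp_rw [this]
      rw [Finset.sum_comm]
      refine Finset.sum_congr rfl fun g _ => ?_
      rw [Finset.sum_comm]
      refine Finset.sum_congr rfl fun e _ => ?_
      rw [← Finset.sum_mul, Finset.card_filter]
      push_cast
      rfl
    have e3 : loadz z a = ∑ g : Finset (Fin 3 → V), ∑ e : Fin 3 → V, Y g e * cnt e a := by
      unfold loadz
      have : ∀ g, ∑ e : Fin 3 → V, Y g e * cnt e a =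
          ∑ i, if G i = g then ∑ e : Fin 3 → V, z i e * cnt e a else 0 := by
        intro g
        simp only [hY]
        rw [← Finset.sum_filter, Finset.sum_comm]
        refine Finset.sum_congr rfl fun e _ => ?_
        rw [Finset.sum_mul]
      rw [Finset.sum_congr rfl fun g _ => this g]
      conv_rhs => rw [Finset.sum_comm]
      simp
    have hYn : ∀ g e, 0 ≤ Y g e := fun g e => Finset.sum_nonneg fun i _ => z1 i e
    have e4 : ∑ i, cnt (f i) a ≤ ∑ g : Finset (Fin 3 → V), ∑ e : Fin 3 → V,
        (Y g e * cnt e a + 3) := by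
      rw [e2]
      refine Finset.sum_le_sum fun g _ => Finset.sum_le_sum fun e _ => ?_
      have h1 : ((Finset.univ.filter (fun i => G i = g ∧ f i = e)).card : ℝ) ≤ Y g e + 1 := by
        have := (Nat.ceil_lt_add_one (hYn g e)).le
        have h2 : ((Finset.univ.filter (fun i => G i = g ∧ f i = e)).card : ℝ) ≤ cap g e := by
          exact_mod_cast hfib g e
        exact h2.trans this
      have := mul_le_mul_of_nonneg_right h1 (cnt_nonneg e a)
      have := cnt_le e a
      linarith
    rw [e1]
    refine e4.trans ?_
    simp only [Finset.sum_add_distrib]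
    rw [← e3]
    have := hβ a
    simp only [Finset.sum_const, Finset.card_univ, nsmul_eq_mul]
    linarith


lemma sort3 {a b c : ℕ} (h1 : a < b) (h2 : b < c) :
    (({a, b, c} : Finset ℕ).sort (· ≤ ·)) = [a, b, c] := by
  have hn : [a, b, c].Nodup := by
    simp; omega
  have h := (List.toFinset_sort (· ≤ ·) hn).2 (by simp; omega)
  simpa using h

lemma image3 (x : Fin 3 → ℕ) : Finset.univ.image x = {x 0, x 1, x 2} := by
  ext a
  simp [Fin.exists_fin_succ, eq_comm]

lemma exists_strict (x : Fin 3 → ℕ) (hx : Function.Injective x) :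
    ∃ σ : Equiv.Perm (Fin 3), x (σ 0) < x (σ 1) ∧ x (σ 1) < x (σ 2) := by
  have hm := Tuple.monotone_sort x
  have hs : StrictMono (x ∘ Tuple.sort x) :=
    hm.strictMono_of_injective (hx.comp (Tuple.sort x).injective)
  exact ⟨Tuple.sort x, hs (by decide), hs (by decide)⟩

lemma image_perm (x : Fin 3 → ℕ) (σ : Equiv.Perm (Fin 3)) :
    Finset.univ.image (fun k => x (σ k)) = Finset.univ.image x := by
  ext a
  simp only [Finset.mem_image, Finset.mem_univ, true_and]
  constructor
  · rintro ⟨k, rfl⟩; exact ⟨_, rfl⟩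
  · rintro ⟨k, rfl⟩; exact ⟨σ.symm k, by simp⟩

lemma dom_lem {n : ℕ} {F : Finset (Finset ℕ)} (hF : StableGraph n F) (x y : Fin 3 → ℕ)
    (hx : Function.Injective x) (hy : Function.Injective y) (hxy : ∀ k, x k ≤ y k)
    (hxn : ∀ k, x k ∈ Finset.Icc 1 n) (h : Finset.univ.image y ∈ F) :
    Finset.univ.image x ∈ F := by
  refine hF _ _ ?_ ?_ h
  · intro a ha
    rw [Finset.mem_image] at ha
    obtain ⟨k, -, rfl⟩ := ha
    exact hxn k
  · obtain ⟨σ, s1, s2⟩ := exists_strict y hy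
    obtain ⟨τ, t1, t2⟩ := exists_strict x hx
    rw [← image_perm y σ, ← image_perm x τ]
    unfold DomLE
    rw [image3, image3, sort3 s1 s2, sort3 t1 t2]
    have key : ∀ k, x (τ k) ≤ y (σ (σ.symm (τ k))) := fun k => by
      rw [Equiv.apply_symm_apply]; exact hxy _
    have k0 := key 0
    have k1 := key 1
    have k2 := key 2
    set ρ : Fin 3 → Fin 3 := fun k => σ.symm (τ k) with hρ
    have hρi : Function.Injective ρ := σ.symm.injective.comp τ.injective
    have r01 : ρ 0 ≠ ρ 1 := fun h => absurd (hρi h) (by decide)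
    have r02 : ρ 0 ≠ ρ 2 := fun h => absurd (hρi h) (by decide)
    have r12 : ρ 1 ≠ ρ 2 := fun h => absurd (hρi h) (by decide)
    change x (τ 0) ≤ y (σ (ρ 0)) at k0
    change x (τ 1) ≤ y (σ (ρ 1)) at k1
    change x (τ 2) ≤ y (σ (ρ 2)) at k2
    have hmax : ∀ j, y (σ j) ≤ y (σ 2) := by
      intro j; fin_cases j <;> simp <;> omega
    have A2 : x (τ 2) ≤ y (σ 2) := k2.trans (hmax _)
    have A0 : x (τ 0) ≤ y (σ 0) ∧ x (τ 1) ≤ y (σ 1) := by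
      generalize ρ 0 = a at *
      generalize ρ 1 = b at *
      generalize ρ 2 = c at *
      fin_cases a <;> fin_cases b <;> fin_cases c <;> simp at * <;> omega
    simp [A0.1, A0.2, A2]

/-- Injective triples whose image is an edge of `F` are at least six per edge. -/
lemma six_card {n : ℕ} {F : Finset (Finset ℕ)} (hF : IsKGraphOn n 3 F) :
    6 * F.card ≤ ((Fintype.piFinset (fun _ : Fin 3 => Finset.Icc 1 n)).filter
      (fun x => Function.Injective x ∧ Finset.univ.image x ∈ F)).card := by
  classical
  have h6 : (Finset.univ : Finset (Equiv.Perm (Fin 3))).card = 6 := by decide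
  rw [← h6, mul_comm, ← Finset.card_product]
  refine Finset.card_le_card_of_injOn (fun p : Finset ℕ × Equiv.Perm (Fin 3) =>
    if h : p.1.card = 3 then (fun k => p.1.orderEmbOfFin h (p.2 k)) else fun _ => 0) ?_ ?_
  · rintro ⟨e, σ⟩ hp
    simp only [Finset.coe_product, Set.mem_prod, Finset.mem_coe] at hp
    obtain ⟨h1, h2⟩ := hF e hp.1
    simp only [h2, dif_pos]
    have him : Finset.univ.image (fun k => e.orderEmbOfFin h2 (σ k)) = e := by
      rw [image_perm (fun k => e.orderEmbOfFin h2 k) σ]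
      exact Finset.image_orderEmbOfFin_univ e h2
    simp only [Finset.coe_filter, Set.mem_ofPred_eq, Fintype.mem_piFinset]
    refine ⟨fun k => h1 (Finset.orderEmbOfFin_mem e h2 _), ?_, ?_⟩
    · exact (e.orderEmbOfFin h2).injective.comp σ.injective
    · rw [him]; exact hp.1
  · rintro ⟨e, σ⟩ hp ⟨e', σ'⟩ hp' heq
    simp only [Finset.coe_product, Set.mem_prod, Finset.mem_coe] at hp hp'
    obtain ⟨h1, h2⟩ := hF e hp.1
    obtain ⟨h1', h2'⟩ := hF e' hp'.1
    simp only [h2, h2', dif_pos] at heq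
    have him : Finset.univ.image (fun k => e.orderEmbOfFin h2 (σ k)) = e := by
      rw [image_perm (fun k => e.orderEmbOfFin h2 k) σ]
      exact Finset.image_orderEmbOfFin_univ e h2
    have him' : Finset.univ.image (fun k => e'.orderEmbOfFin h2' (σ' k)) = e' := by
      rw [image_perm (fun k => e'.orderEmbOfFin h2' k) σ']
      exact Finset.image_orderEmbOfFin_univ e' h2'
    have hee : e = e' := by rw [← him, ← him', heq]
    subst hee
    have : σ = σ' := by
      ext k
      have := congrFun heq k
      exact congrArg Fin.val ((e.orderEmbOfFin h2).injective this)
    rw [this]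


/-- Block version of a stable graph. -/
def GB (ℓ L : ℕ) (F : Finset (Finset ℕ)) : Finset (Fin 3 → Fin L) :=
  Finset.univ.filter (fun e => (∀ j k, e j = e k → j = k) ∧
    Finset.univ.image (fun k => ((e k).1 + 1) * ℓ) ∈ F)

lemma mem_GB {ℓ L : ℕ} {F : Finset (Finset ℕ)} {e : Fin 3 → Fin L} :
    e ∈ GB ℓ L F ↔ (∀ j k, e j = e k → j = k) ∧
      Finset.univ.image (fun k => ((e k).1 + 1) * ℓ) ∈ F := by
  simp [GB]

lemma blk_inj {ℓ L : ℕ} (hℓ : 0 < ℓ) {e : Fin 3 → Fin L} (he : ∀ j k, e j = e k → j = k) :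
    Function.Injective (fun k => ((e k).1 + 1) * ℓ) := by
  intro j k h
  have := Nat.eq_of_mul_eq_mul_right hℓ h
  exact he j k (Fin.ext (by omega))

lemma GB_dom {n ℓ L : ℕ} (hℓ : 0 < ℓ) (hn : L * ℓ ≤ n) {F : Finset (Finset ℕ)}
    (hF : StableGraph n F) {e c : Fin 3 → Fin L} (he : e ∈ GB ℓ L F)
    (hc : ∀ j k, c j = c k → j = k) (hce : ∀ k, (c k).1 ≤ (e k).1) : c ∈ GB ℓ L F := by
  rw [mem_GB] at he ⊢
  refine ⟨hc, dom_lem hF _ _ (blk_inj hℓ hc) (blk_inj hℓ he.1) ?_ ?_ he.2⟩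
  · intro k
    exact Nat.mul_le_mul_right _ (by have := hce k; omega)
  · intro k
    rw [Finset.mem_Icc]
    refine ⟨Nat.mul_pos (by omega) hℓ, le_trans (Nat.mul_le_mul_right _ ?_) hn⟩
    have := (c k).2
    omega

theorem match_lem {n m ℓ L : ℕ} (hn : L * ℓ ≤ n) (F : Fin m → Finset (Finset ℕ))
    (hF : ∀ i, StableGraph n (F i)) (f : Fin m → Fin 3 → Fin L) (hf : ∀ i, f i ∈ GB ℓ L (F i))
    (hcap : ∀ a, ((Finset.univ : Finset (Fin m × Fin 3)).filter
      (fun p => f p.1 p.2 = a)).card ≤ ℓ) : HasRainbowMatching F := by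
  classical
  have hemb : ∀ a, ∃ φ : {p : Fin m × Fin 3 // f p.1 p.2 = a} → Fin ℓ, Function.Injective φ := by
    intro a
    have : Fintype.card {p : Fin m × Fin 3 // f p.1 p.2 = a} ≤ Fintype.card (Fin ℓ) := by
      rw [Fintype.card_subtype, Fintype.card_fin]; exact hcap a
    obtain ⟨φ⟩ := Function.Embedding.nonempty_of_card_le this
    exact ⟨φ, φ.injective⟩
  choose φ hφ using hemb
  set x : Fin m × Fin 3 → ℕ := fun p => (f p.1 p.2).1 * ℓ + (φ (f p.1 p.2) ⟨p, rfl⟩).1 + 1 with hx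
  have hxinj : Function.Injective x := by
    intro p q h
    have hp := (φ (f p.1 p.2) ⟨p, rfl⟩).2
    have hq := (φ (f q.1 q.2) ⟨q, rfl⟩).2
    have hl : 0 < ℓ := by omega
    have h' : (f p.1 p.2).1 * ℓ + (φ (f p.1 p.2) ⟨p, rfl⟩).1 =
      (f q.1 q.2).1 * ℓ + (φ (f q.1 q.2) ⟨q, rfl⟩).1 := by
      have := h; simp only [hx] at this; omega
    have e1 : (f p.1 p.2).1 = (f q.1 q.2).1 := by
      have h2 := congrArg (· / ℓ) h'
      simp only [Nat.mul_comm _ ℓ, Nat.mul_add_div hl, Nat.div_eq_of_lt hp,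
        Nat.div_eq_of_lt hq] at h2
      exact h2
    have e2 : f p.1 p.2 = f q.1 q.2 := Fin.ext e1
    have e3 : (φ (f p.1 p.2) ⟨p, rfl⟩).1 = (φ (f q.1 q.2) ⟨q, rfl⟩).1 := by
      rw [e1] at h'; omega
    have e4 : ∀ a (hq : f q.1 q.2 = a), φ (f q.1 q.2) ⟨q, rfl⟩ = φ a ⟨q, hq⟩ := by
      rintro _ rfl; rfl
    rw [e4 _ e2.symm] at e3
    have := hφ _ (Fin.ext e3)
    exact congrArg Subtype.val this
  refine ⟨fun i => Finset.univ.image (fun k => x (i, k)), ?_, ?_⟩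
  · intro i
    obtain ⟨h1, h2⟩ := mem_GB.1 (hf i)
    have hl : 0 < ℓ := by
      have := (φ (f i 0) ⟨(i, 0), rfl⟩).2
      omega
    have hle : ∀ k, x (i, k) ≤ ((f i k).1 + 1) * ℓ := by
      intro k
      have := (φ (f i k) ⟨(i, k), rfl⟩).2
      simp only [hx]
      rw [Nat.add_mul]
      omega
    refine dom_lem (hF i) _ _ ?_ (blk_inj hl h1) hle ?_ h2
    · intro j k h
      have := hxinj h
      simpa using this
    · intro k
      rw [Finset.mem_Icc]
      refine ⟨by simp only [hx]; omega, (hle k).trans (le_trans (Nat.mul_le_mul_right _ ?_) hn)⟩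
      have := (f i k).2
      omega
  · intro i j hij
    rw [Finset.disjoint_left]
    intro a ha hb
    simp only [Finset.mem_image, Finset.mem_univ, true_and] at ha hb
    obtain ⟨k, rfl⟩ := ha
    obtain ⟨k', hk'⟩ := hb
    have := hxinj hk'
    exact hij (congrArg Prod.fst this).symm

lemma prod_upd (n a : ℕ) (j : Fin 3) : ∏ k : Fin 3, (if k = j then a else n) = a * n ^ 2 := by
  fin_cases j <;> simp [Fin.prod_univ_three] <;> ring

lemma cyl_card (n : ℕ) (A : Finset ℕ) (j : Fin 3) :
    ((Fintype.piFinset (fun _ : Fin 3 => Finset.Icc 1 n)).filter (fun x => x j ∈ A)).card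
      ≤ A.card * n ^ 2 := by
  classical
  calc _ ≤ (Fintype.piFinset (fun k : Fin 3 => if k = j then A else Finset.Icc 1 n)).card := by
        refine Finset.card_le_card fun x hx => ?_
        rw [Finset.mem_filter, Fintype.mem_piFinset] at hx
        rw [Fintype.mem_piFinset]
        intro k
        split_ifs with h
        · rw [h]; exact hx.2
        · exact hx.1 k
    _ = _ := by
        rw [Fintype.card_piFinset, ← prod_upd n A.card j]
        refine Finset.prod_congr rfl fun k _ => ?_
        split_ifs <;> simp

lemma cyl3_card (n : ℕ) (A : Finset ℕ) :
    ((Fintype.piFinset (fun _ : Fin 3 => Finset.Icc 1 n)).filter (fun x => ∃ j, x j ∈ A)).card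
      ≤ 3 * A.card * n ^ 2 := by
  classical
  calc _ ≤ ((Finset.univ : Finset (Fin 3)).biUnion (fun j =>
        (Fintype.piFinset (fun _ : Fin 3 => Finset.Icc 1 n)).filter (fun x => x j ∈ A))).card := by
        refine Finset.card_le_card fun x hx => ?_
        simp only [Finset.mem_filter, Finset.mem_biUnion, Finset.mem_univ, true_and] at hx ⊢
        obtain ⟨h, j, hj⟩ := hx
        exact ⟨j, h, hj⟩
    _ ≤ ∑ j : Fin 3, A.card * n ^ 2 := Finset.card_biUnion_le.trans
        (Finset.sum_le_sum fun j _ => cyl_card n A j)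
    _ = _ := by simp; ring

lemma pair_card (n ℓ : ℕ) (j k : Fin 3) (hjk : j ≠ k) (hℓ : 0 < ℓ) :
    ((Fintype.piFinset (fun _ : Fin 3 => Finset.Icc 1 n)).filter
      (fun x => (x j - 1) / ℓ = (x k - 1) / ℓ)).card ≤ ℓ * n ^ 2 := by
  classical
  calc _ ≤ (Fintype.piFinset (fun i : Fin 3 => if i = k then Finset.range ℓ else
          Finset.Icc 1 n)).card := by
        refine Finset.card_le_card_of_injOn
          (fun x => Function.update x k ((x k - 1) % ℓ)) ?_ ?_
        · intro x hx
          simp only [Finset.coe_filter, Set.mem_ofPred_eq, Fintype.mem_piFinset] at hx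
          simp only [Finset.mem_coe, Fintype.mem_piFinset]
          intro i
          by_cases h : i = k
          · subst h
            simp [Nat.mod_lt _ hℓ]
          · simp only [h, if_false, Function.update_of_ne, ne_eq, not_false_eq_true]
            exact hx.1 i
        · intro x hx y hy hxy
          simp only [Finset.coe_filter, Set.mem_ofPred_eq, Fintype.mem_piFinset,
            Finset.mem_Icc] at hx hy
          have h1 : ∀ i, i ≠ k → x i = y i := by
            intro i hi
            have := congrFun hxy i
            simpa [Function.update_of_ne hi] using this
          have h2 : (x k - 1) % ℓ = (y k - 1) % ℓ := by
            have := congrFun hxy k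
            simpa using this
          have h3 : (x k - 1) / ℓ = (y k - 1) / ℓ := by
            rw [← hx.2, ← hy.2, h1 j hjk]
          have h4 : x k - 1 = y k - 1 := by
            rw [← Nat.div_add_mod (x k - 1) ℓ, ← Nat.div_add_mod (y k - 1) ℓ, h2, h3]
          funext i
          by_cases h : i = k
          · subst h
            have := hx.1 i
            have := hy.1 i
            omega
          · exact h1 i h
    _ = _ := by
        rw [Fintype.card_piFinset, ← prod_upd n ℓ k]
        refine Finset.prod_congr rfl fun k _ => ?_
        split_ifs <;> simp

def badT (ℓ : ℕ) (x : Fin 3 → ℕ) : Prop :=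
  (∃ j, x j ∈ Finset.Icc 1 ℓ) ∨ (x 0 - 1) / ℓ = (x 1 - 1) / ℓ ∨ (x 0 - 1) / ℓ = (x 2 - 1) / ℓ ∨
    (x 1 - 1) / ℓ = (x 2 - 1) / ℓ

open Classical in
lemma bad_card (n ℓ : ℕ) (hℓ : 0 < ℓ) :
    ((Fintype.piFinset (fun _ : Fin 3 => Finset.Icc 1 n)).filter (badT ℓ)).card
      ≤ 6 * ℓ * n ^ 2 := by
  have h0 := cyl3_card n (Finset.Icc 1 ℓ)
  have h1 := pair_card n ℓ 0 1 (by decide) hℓ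
  have h2 := pair_card n ℓ 0 2 (by decide) hℓ
  have h3 := pair_card n ℓ 1 2 (by decide) hℓ
  simp only [Nat.card_Icc, Nat.add_sub_cancel] at h0
  refine le_trans (Finset.card_le_card (t := _ ∪ (_ ∪ (_ ∪ _))) ?_)
    ((Finset.card_union_le _ _).trans (Nat.add_le_add h0 ((Finset.card_union_le _ _).trans
    (Nat.add_le_add h1 ((Finset.card_union_le _ _).trans (Nat.add_le_add h2 h3)))))) |>.trans ?_
  · intro x hx
    simp only [Finset.mem_filter, badT, Finset.mem_union] at hx ⊢
    tauto
  · apply le_of_eq; ring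

lemma good_lem {n ℓ L : ℕ} (hℓ : 0 < ℓ) (hn' : n < (L + 1) * ℓ)
    {F : Finset (Finset ℕ)} (hF : StableGraph n F) (x : Fin 3 → ℕ)
    (hxn : ∀ k, x k ∈ Finset.Icc 1 n) (hxi : Function.Injective x)
    (hxF : Finset.univ.image x ∈ F) (hb : ¬ badT ℓ x) :
    ∃ e ∈ GB ℓ L F, ∀ k, (e k).1 + 1 = (x k - 1) / ℓ := by
  unfold badT at hb
  push Not at hb
  obtain ⟨b0, b1, b2, b3⟩ := hb
  have hlt : ∀ k, (x k - 1) / ℓ - 1 < L := by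
    intro k
    have h1 := Finset.mem_Icc.1 (hxn k)
    have : (x k - 1) / ℓ < L + 1 := by
      rw [Nat.div_lt_iff_lt_mul hℓ]; omega
    have h3 : ℓ < x k := by
      have := b0 k
      rw [Finset.mem_Icc] at this
      omega
    have h2 : 1 ≤ (x k - 1) / ℓ := by
      rw [Nat.le_div_iff_mul_le hℓ]; omega
    omega
  have hge : ∀ k, 1 ≤ (x k - 1) / ℓ := by
    intro k
    have h1 := Finset.mem_Icc.1 (hxn k)
    have h3 : ℓ < x k := by
      have := b0 k
      rw [Finset.mem_Icc] at this
      omega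
    rw [Nat.le_div_iff_mul_le hℓ]; omega
  have heq : ∀ k, (x k - 1) / ℓ - 1 + 1 = (x k - 1) / ℓ := fun k => by
    have := hge k; omega
  refine ⟨fun k => ⟨(x k - 1) / ℓ - 1, hlt k⟩, ?_, fun k => heq k⟩
  have hinj : ∀ j k : Fin 3, (x j - 1) / ℓ = (x k - 1) / ℓ → j = k := by
    intro j k h
    fin_cases j <;> fin_cases k <;> simp at h ⊢ <;> omega
  rw [mem_GB]
  constructor
  · intro j k h
    have h' := congrArg Fin.val h
    simp only at h'
    exact hinj j k (by rw [← heq j, ← heq k, h'])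
  · simp only [heq]
    refine dom_lem hF _ x ?_ hxi ?_ ?_ hxF
    · intro j k h
      exact hinj j k (Nat.eq_of_mul_eq_mul_right hℓ h)
    · intro k
      have := Nat.div_mul_le_self (x k - 1) ℓ
      omega
    · intro k
      have := Nat.div_mul_le_self (x k - 1) ℓ
      have h1 := Finset.mem_Icc.1 (hxn k)
      rw [Finset.mem_Icc]
      refine ⟨Nat.mul_pos (hge k) hℓ, by omega⟩

theorem count_GB {n ℓ L : ℕ} (hℓ : 0 < ℓ) (hn' : n < (L + 1) * ℓ)
    {F : Finset (Finset ℕ)} (hF : StableGraph n F) (hK : IsKGraphOn n 3 F) :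
    6 * F.card ≤ ℓ ^ 3 * (GB ℓ L F).card + 6 * ℓ * n ^ 2 := by
  classical
  refine (six_card hK).trans ?_
  set T := Fintype.piFinset (fun _ : Fin 3 => Finset.Icc 1 n) with hT
  set P := T.filter (fun x => Function.Injective x ∧ Finset.univ.image x ∈ F) with hP
  have h1 : P.card = (P.filter (badT ℓ)).card + (P.filter (fun x => ¬ badT ℓ x)).card :=
    (Finset.card_filter_add_card_filter_not _).symm
  have h2 : (P.filter (badT ℓ)).card ≤ 6 * ℓ * n ^ 2 := by
    refine le_trans (Finset.card_le_card ?_) (bad_card n ℓ hℓ)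
    exact Finset.filter_subset_filter _ (Finset.filter_subset _ _)
  have h3 : (P.filter (fun x => ¬ badT ℓ x)).card ≤ ℓ ^ 3 * (GB ℓ L F).card := by
    have hc : ((GB ℓ L F) ×ˢ (Fintype.piFinset (fun _ : Fin 3 => Finset.range ℓ))).card
        = ℓ ^ 3 * (GB ℓ L F).card := by
      rw [Finset.card_product, Fintype.card_piFinset]
      simp [mul_comm]
    have hg : ∀ x ∈ P.filter (fun x => ¬ badT ℓ x),
        ∃ e ∈ GB ℓ L F, ∀ k, (e k).1 + 1 = (x k - 1) / ℓ := by
      intro x hx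
      simp only [hP, hT, Finset.mem_filter, Fintype.mem_piFinset] at hx
      exact good_lem hℓ hn' hF x hx.1.1 hx.1.2.1 hx.1.2.2 hx.2
    rw [← hc]
    refine le_trans (Finset.card_le_card ?_) (Finset.card_image_le
      (f := fun p : (Fin 3 → Fin L) × (Fin 3 → ℕ) => fun k => ((p.1 k).1 + 1) * ℓ + p.2 k + 1))
    intro x hx
    obtain ⟨e, he, hek⟩ := hg x hx
    simp only [hP, hT, Finset.mem_filter, Fintype.mem_piFinset, Finset.mem_Icc] at hx
    rw [Finset.mem_image]
    refine ⟨(e, fun k => (x k - 1) % ℓ), ?_, ?_⟩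
    · simp [he, Nat.mod_lt _ hℓ]
    · funext k
      have h5 := Nat.div_add_mod (x k - 1) ℓ
      have h6 := hx.1.1 k
      simp only [hek]
      rw [mul_comm]
      omega
  omega


lemma diff_count {n ℓ L : ℕ} (hℓ : 0 < ℓ) (hn' : n < (L + 1) * ℓ)
    {F : Finset (Finset ℕ)} (hF : StableGraph n F) (hK : IsKGraphOn n 3 F)
    (R : Finset (Finset ℕ)) (B : Finset (Fin 3 → ℕ))
    (hB : ∀ x ∈ Fintype.piFinset (fun _ : Fin 3 => Finset.Icc 1 n), Function.Injective x →
      Finset.univ.image x ∉ R → ∀ e ∈ GB ℓ L F, (∀ k, (e k).1 + 1 = (x k - 1) / ℓ) → x ∈ B) :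
    6 * (F \ R).card ≤ 6 * ℓ * n ^ 2 + B.card := by
  classical
  have hK' : IsKGraphOn n 3 (F \ R) := fun e he => hK e (Finset.mem_sdiff.1 he).1
  refine (six_card hK').trans ?_
  refine le_trans (Finset.card_le_card ?_) ((Finset.card_union_le
    ((Fintype.piFinset (fun _ : Fin 3 => Finset.Icc 1 n)).filter (badT ℓ)) B).trans
    (Nat.add_le_add_right (bad_card n ℓ hℓ) _))
  intro x hx
  simp only [Finset.mem_filter, Finset.mem_sdiff] at hx
  obtain ⟨h1, h2, h3, h4⟩ := hx
  rw [Finset.mem_union, Finset.mem_filter]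
  by_cases hb : badT ℓ x
  · exact Or.inl ⟨h1, hb⟩
  · right
    obtain ⟨e, he, hek⟩ := good_lem hℓ hn' hF x (Fintype.mem_piFinset.1 h1) h2 h3 hb
    exact hB x h1 h2 h4 e he hek

lemma blk_le {x ℓ a b : ℕ} (hℓ : 0 < ℓ) (h : a + 1 = (x - 1) / ℓ) (hab : a < b) :
    x ≤ (b + 1) * ℓ := by
  have h1 : (x - 1) / ℓ < b + 1 := by omega
  rw [Nat.div_lt_iff_lt_mul hℓ] at h1
  omega

lemma image_mem_pow {n : ℕ} {x : Fin 3 → ℕ} (hxi : Function.Injective x)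
    (h : ∀ k, x k ∈ Finset.Icc 1 n) :
    Finset.univ.image x ∈ (Finset.Icc 1 n).powersetCard 3 := by
  rw [Finset.mem_powersetCard]
  constructor
  · intro a ha
    rw [Finset.mem_image] at ha
    obtain ⟨k, -, rfl⟩ := ha
    exact h k
  · rw [Finset.card_image_of_injective _ hxi]
    simp

lemma S_case {n ℓ L m k : ℕ} (hℓ : 0 < ℓ) (hn' : n < (L + 1) * ℓ)
    {F : Finset (Finset ℕ)} (hF : StableGraph n F) (hK : IsKGraphOn n 3 F)
    (hG : ∀ e ∈ GB ℓ L F, ∃ j, (e j).1 < k) :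
    6 * (F \ SGraph n m 3).card ≤ 6 * ℓ * n ^ 2 + 3 * ((k + 1) * ℓ + 1 - m) * n ^ 2 := by
  have hc := cyl3_card n (Finset.Icc m ((k + 1) * ℓ))
  rw [Nat.card_Icc] at hc
  refine le_trans (diff_count hℓ hn' hF hK (SGraph n m 3) _ ?_) (Nat.add_le_add_left hc _)
  intro x hx hxi hxS e he hek
  rw [Finset.mem_filter]
  refine ⟨hx, ?_⟩
  obtain ⟨j, hj⟩ := hG e he
  refine ⟨j, ?_⟩
  rw [Finset.mem_Icc]
  refine ⟨?_, blk_le hℓ (hek j) hj⟩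
  by_contra hlt
  push Not at hlt
  apply hxS
  rw [Fintype.mem_piFinset] at hx
  unfold SGraph
  rw [Finset.mem_filter]
  refine ⟨image_mem_pow hxi hx, x j, ?_⟩
  rw [Finset.mem_inter, Finset.mem_Icc]
  have := Finset.mem_Icc.1 (hx j)
  exact ⟨Finset.mem_image_of_mem _ (Finset.mem_univ _), this.1, by omega⟩

lemma D_case {n ℓ L m u q : ℕ} (hℓ : 0 < ℓ) (hn' : n < (L + 1) * ℓ)
    {F : Finset (Finset ℕ)} (hF : StableGraph n F) (hK : IsKGraphOn n 3 F)
    (hG : ∀ e ∈ GB ℓ L F, (∃ j, (e j).1 < u) ∨ ∀ j, (e j).1 < q) :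
    6 * (F \ DGraph n m 3).card ≤ 6 * ℓ * n ^ 2 + (3 * ((u + 1) * ℓ) * n ^ 2 +
      3 * ((q + 1) * ℓ + 1 - 3 * m) * n ^ 2) := by
  classical
  have hc := cyl3_card n (Finset.Icc 1 ((u + 1) * ℓ))
  have hc' := cyl3_card n (Finset.Icc (3 * m) ((q + 1) * ℓ))
  rw [Nat.card_Icc] at hc hc'
  rw [Nat.add_sub_cancel] at hc
  refine le_trans (diff_count hℓ hn' hF hK (DGraph n m 3) _ ?_) (Nat.add_le_add_left
    ((Finset.card_union_le _ _).trans (Nat.add_le_add hc hc')) _)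
  intro x hx hxi hxS e he hek
  have hx' := Fintype.mem_piFinset.1 hx
  rw [Finset.mem_union, Finset.mem_filter, Finset.mem_filter]
  rcases hG e he with ⟨j, hj⟩ | h
  · left
    refine ⟨hx, j, ?_⟩
    rw [Finset.mem_Icc]
    exact ⟨(Finset.mem_Icc.1 (hx' j)).1, blk_le hℓ (hek j) hj⟩
  · right
    refine ⟨hx, ?_⟩
    by_contra hlt
    push Not at hlt
    apply hxS
    unfold DGraph
    refine image_mem_pow hxi fun k => ?_
    have h1 := hlt k
    have h2 := blk_le hℓ (hek k) (h k)
    have h3 := Finset.mem_Icc.1 (hx' k)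
    rw [Finset.mem_Icc] at h1 ⊢
    omega

lemma skip_lem {L : ℕ} (U : Finset (Fin L)) : ∃ g : Fin (L - U.card) → Fin L,
    StrictMono g ∧ (∀ i, g i ∉ U) ∧ ∀ i, i.1 ≤ (g i).1 ∧ (g i).1 ≤ i.1 + U.card := by
  have hc : Uᶜ.card = L - U.card := by rw [Finset.card_compl, Fintype.card_fin]
  have hsm : StrictMono (Uᶜ.orderEmbOfFin hc) := (Uᶜ.orderEmbOfFin hc).strictMono
  set g := Uᶜ.orderEmbOfFin hc with hg
  refine ⟨g, hsm, fun i => ?_, fun i => ?_⟩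
  · exact Finset.mem_compl.1 (Finset.orderEmbOfFin_mem _ hc i)
  · have key : ∀ d : ℕ, ∀ a b : Fin (L - U.card), b.1 = a.1 + d → (g a).1 + d ≤ (g b).1 := by
      intro d
      induction d with
      | zero => intro a b h; have : a = b := Fin.ext (by omega); rw [this]; simp
      | succ d ih =>
        intro a b h
        have hb := b.2
        have h1 := ih a ⟨a.1 + d, by omega⟩ rfl
        have h2 : g ⟨a.1 + d, by omega⟩ < g b := hsm (by rw [Fin.lt_def]; simp; omega)
        rw [Fin.lt_def] at h2
        omega
    have hi := i.2
    have hU : U.card ≤ L := by simpa using Finset.card_le_univ U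
    constructor
    · have := key i.1 ⟨0, by omega⟩ i (by simp)
      omega
    · have h1 := key (L - U.card - 1 - i.1) i ⟨L - U.card - 1, by omega⟩ (by simp; omega)
      have h2 := (g ⟨L - U.card - 1, by omega⟩).2
      omega

lemma S_struct {L : ℕ} (G : Finset (Fin 3 → Fin L))
    (hG1 : ∀ e ∈ G, ∀ j k, e j = e k → j = k)
    (hG2 : ∀ e ∈ G, ∀ c : Fin 3 → Fin L, (∀ j k, c j = c k → j = k) →
      (∀ k, (c k).1 ≤ (e k).1) → c ∈ G)
    (w : Fin L → ℝ) (hw : ∀ e ∈ G, 1 ≤ ∑ k, w (e k)) (U : Finset (Fin L))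
    (hU : ∀ a, a ∉ U → w a ≤ 0) : ∀ e ∈ G, ∃ j, (e j).1 < U.card := by
  intro e he
  by_contra hcon
  push Not at hcon
  obtain ⟨g, g1, g2, g3⟩ := skip_lem U
  have hlt : ∀ j, (e j).1 - U.card < L - U.card := fun j => by
    have := (e j).2; have := hcon j; omega
  have hc : (fun j => g ⟨(e j).1 - U.card, hlt j⟩) ∈ G := by
    refine hG2 e he _ ?_ ?_
    · intro j k h
      have h1 := congrArg Fin.val (g1.injective h)
      simp only at h1
      have := hcon j
      have := hcon k
      exact hG1 e he j k (Fin.ext (by omega))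
    · intro k
      have h1 := (g3 ⟨(e k).1 - U.card, hlt k⟩).2
      have := hcon k
      simp only at h1
      omega
  have h1 := hw _ hc
  have h2 : ∑ k, w (g ⟨(e k).1 - U.card, hlt k⟩) ≤ ∑ k : Fin 3, (0:ℝ) :=
    Finset.sum_le_sum fun k _ => hU _ (g2 _)
  simp only [Finset.sum_const_zero] at h2
  linarith

lemma D_struct {L : ℕ} (G : Finset (Fin 3 → Fin L))
    (hG2 : ∀ e ∈ G, ∀ c : Fin 3 → Fin L, (∀ j k, c j = c k → j = k) →
      (∀ k, (c k).1 ≤ (e k).1) → c ∈ G)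
    (w : Fin L → ℝ) (hw : ∀ e ∈ G, 1 ≤ ∑ k, w (e k)) (U W : Finset (Fin L))
    (hU : ∀ a, a ∉ U → w a ≤ 0) (hW : ∀ a, a ∉ W → w a ≤ 1 / 3) :
    ∀ e ∈ G, (∃ j, (e j).1 < W.card + 1) ∨ ∀ j, (e j).1 < U.card + W.card + 2 := by
  intro e he
  by_contra hcon
  push Not at hcon
  obtain ⟨h1, j0, h2⟩ := hcon
  obtain ⟨g, g1, g2, g3⟩ := skip_lem U
  obtain ⟨r, r1, r2, r3⟩ := skip_lem W
  have hL := (e j0).2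
  set A := g ⟨W.card + 2, by omega⟩ with hA
  set B := r ⟨0, by omega⟩ with hB
  set C := r ⟨1, by omega⟩ with hC
  have a1 : W.card + 2 ≤ A.1 ∧ A.1 ≤ W.card + 2 + U.card := g3 ⟨W.card + 2, by omega⟩
  have b1 : B.1 ≤ 0 + W.card := (r3 ⟨0, by omega⟩).2
  have c1 : C.1 ≤ 1 + W.card := (r3 ⟨1, by omega⟩).2
  have bc : B < C := r1 (by rw [Fin.lt_def]; simp)
  have wA : w A ≤ 0 := hU _ (g2 _)
  have wB : w B ≤ 1 / 3 := hW _ (r2 _)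
  have wC : w C ≤ 1 / 3 := hW _ (r2 _)
  have nBC : B ≠ C := bc.ne
  have nAB : A ≠ B := fun h => by rw [h] at a1; omega
  have nAC : A ≠ C := fun h => by rw [h] at a1; omega
  clear_value A B C
  have key : ∀ c : Fin 3 → Fin L, (∀ j k, c j = c k → j = k) →
      (∀ k, (c k).1 ≤ (e k).1) → 1 ≤ w (c 0) + w (c 1) + w (c 2) := by
    intro c q1 q2
    have := hw _ (hG2 e he c q1 q2)
    rwa [Fin.sum_univ_three] at this
  have e0 := h1 0
  have e1 := h1 1
  have e2 := h1 2
  have inj3 : ∀ X Y Z : Fin L, X ≠ Y → X ≠ Z → Y ≠ Z →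
      ∀ j k : Fin 3, (![X, Y, Z] : Fin 3 → Fin L) j = (![X, Y, Z] : Fin 3 → Fin L) k → j = k := by
    intro X Y Z q1 q2 q3 j k h
    fin_cases j <;> fin_cases k <;> simp_all
  have le3 : ∀ X Y Z : Fin L, X.1 ≤ (e 0).1 → Y.1 ≤ (e 1).1 → Z.1 ≤ (e 2).1 →
      ∀ k, ((![X, Y, Z] : Fin 3 → Fin L) k).1 ≤ (e k).1 := by
    intro X Y Z q1 q2 q3 k
    fin_cases k
    · exact q1
    · exact q2
    · exact q3
  have hj : j0 = 0 ∨ j0 = 1 ∨ j0 = 2 := by fin_cases j0 <;> simp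
  rcases hj with rfl | rfl | rfl
  · have := key ![A, B, C] (inj3 _ _ _ nAB nAC nBC) (le3 _ _ _ (by omega) (by omega) (by omega))
    simp at this
    linarith
  · have := key ![B, A, C] (inj3 _ _ _ nAB.symm nBC nAC) (le3 _ _ _ (by omega) (by omega) (by omega))
    simp at this
    linarith
  · have := key ![B, C, A] (inj3 _ _ _ nBC nAB.symm nAC.symm)
      (le3 _ _ _ (by omega) (by omega) (by omega))
    simp at this
    linarith


lemma HF_diff {n m : ℕ} (R : Finset (Finset ℕ)) (F : Fin m → Finset (Finset ℕ)) :
    (HF n (fun _ : Fin m => R) \ HF n F).card ≤ ∑ i, (R \ F i).card := by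
  classical
  calc _ ≤ (Finset.univ.biUnion (fun i : Fin m =>
        (R \ F i).image (fun e => insert (n + i.1 + 1) e))).card := by
        refine Finset.card_le_card fun x hx => ?_
        simp only [HF, Finset.mem_sdiff, Finset.mem_biUnion, Finset.mem_univ, true_and,
          Finset.mem_image, not_exists, not_and] at hx ⊢
        obtain ⟨⟨i, e, he, rfl⟩, h2⟩ := hx
        exact ⟨i, e, ⟨he, fun h => h2 i e h rfl⟩, rfl⟩
    _ ≤ ∑ i, ((R \ F i).image (fun e => insert (n + i.1 + 1) e)).card := Finset.card_biUnion_le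
    _ ≤ _ := Finset.sum_le_sum fun i _ => Finset.card_image_le

lemma card_SG {n m : ℕ} (hm : 0 < m) (hmn : m ≤ n) :
    (SGraph n m 3).card ≤ Nat.choose n 3 - Nat.choose (n - m + 1) 3 := by
  classical
  have h1 : (SGraph n m 3).card + ((Finset.Icc m n).powersetCard 3).card ≤
      ((Finset.Icc 1 n).powersetCard 3).card := by
    rw [← Finset.card_union_of_disjoint]
    · refine Finset.card_le_card (Finset.union_subset (Finset.filter_subset _ _) ?_)
      exact Finset.powersetCard_mono (Finset.Icc_subset_Icc hm le_rfl)
    · rw [Finset.disjoint_left]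
      intro e he he'
      unfold SGraph at he
      rw [Finset.mem_filter] at he
      obtain ⟨a, ha⟩ := he.2
      rw [Finset.mem_inter] at ha
      have h2 := (Finset.mem_powersetCard.1 he').1 ha.1
      have h3 := ha.2
      rw [Finset.mem_Icc] at h2 h3
      omega
  rw [Finset.card_powersetCard, Finset.card_powersetCard, Nat.card_Icc, Nat.card_Icc] at h1
  have : n + 1 - m = n - m + 1 := by omega
  rw [this] at h1
  simp only [Nat.add_sub_cancel] at h1
  omega

lemma card_DG (n m : ℕ) : (DGraph n m 3).card = Nat.choose (3 * m - 1) 3 := by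
  unfold DGraph
  rw [Finset.card_powersetCard, Nat.card_Icc, Nat.add_sub_cancel]

lemma choose3 (a : ℕ) : 6 * (Nat.choose a 3 : ℝ) = a * (a - 1) * (a - 2) := by
  induction a with
  | zero => simp
  | succ a ih =>
    have h2 : 2 * (Nat.choose a 2 : ℝ) = a * (a - 1) := by
      rw [Nat.cast_choose_two]; ring
    rw [Nat.choose_succ_succ' a 2]
    push_cast
    linear_combination ih + 3 * h2

lemma f_lower {n m N : ℕ} (hm : 0 < m) (hmn : 3 * m ≤ n) (hN : fEMC n m 3 < N) :
    27 * (m:ℝ) ^ 3 - 54 * n ^ 2 ≤ 6 * N ∧ (n:ℝ) ^ 3 - (n - m) ^ 3 - 54 * n ^ 2 ≤ 6 * N := by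
  unfold fEMC at hN
  obtain ⟨h1, h2⟩ := max_lt_iff.1 hN
  have hm1 : (1:ℝ) ≤ m := by exact_mod_cast hm
  have hmn' : 3 * (m:ℝ) ≤ n := by exact_mod_cast hmn
  constructor
  · have a1 := choose3 (3 * m - 1)
    rw [Nat.cast_sub (by omega)] at a1
    push_cast at a1
    have a2 : (Nat.choose (3 * m - 1) 3 : ℝ) ≤ N := by exact_mod_cast h2.le
    nlinarith
  · have a1 := choose3 n
    have a2 := choose3 (n - m + 1)
    rw [Nat.cast_add, Nat.cast_sub (by omega)] at a2
    push_cast at a2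
    have a3 : (Nat.choose n 3 : ℝ) ≤ Nat.choose (n - m + 1) 3 + N := by
      have : Nat.choose n 3 ≤ Nat.choose (n - m + 1) 3 + N := by omega
      exact_mod_cast this
    have : 0 ≤ (n:ℝ) ^ 2 := by positivity
    have e : 6 * (N:ℝ) ≥ n * (n - 1) * (n - 2) - (n - m + 1) * (n - m + 1 - 1) * (n - m + 1 - 2) := by
      linarith
    have e2 : (n:ℝ) * (n - 1) * (n - 2) - (n - m + 1) * (n - m + 1 - 1) * (n - m + 1 - 2) =
      n ^ 3 - (n - m) ^ 3 - 3 * n ^ 2 + 2 * n + (n - m) := by ring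
    linarith

lemma card_le_N3 {V : Type*} [Fintype V] [DecidableEq V] (w : V → ℝ) (G : Finset (Fin 3 → V))
    (h : ∀ e ∈ G, 1 ≤ ∑ k, w (e k)) :
    (G.card : ℝ) ≤ ∑ a, ∑ b, ∑ c, ind (w a + w b + w c) := by
  have h1 : ∑ a, ∑ b, ∑ c, ind (w a + w b + w c) =
      ∑ p : V × V × V, ind (w p.1 + w p.2.1 + w p.2.2) := by
    rw [Fintype.sum_prod_type]
    refine Finset.sum_congr rfl fun a _ => ?_
    rw [Fintype.sum_prod_type]
  rw [h1]
  have hinj : Set.InjOn (fun e : Fin 3 → V => (e 0, e 1, e 2)) G := by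
    intro e _ e' _ h
    simp only [Prod.mk.injEq] at h
    funext k
    fin_cases k
    · exact h.1
    · exact h.2.1
    · exact h.2.2
  calc (G.card : ℝ) = ∑ e ∈ G, (1:ℝ) := by simp
    _ = ∑ e ∈ G, ind (w (e 0) + w (e 1) + w (e 2)) := by
        refine Finset.sum_congr rfl fun e he => ?_
        have := h e he
        rw [Fin.sum_univ_three] at this
        rw [ind_of_le this]
    _ = ∑ p ∈ G.image (fun e : Fin 3 → V => (e 0, e 1, e 2)),
          ind (w p.1 + w p.2.1 + w p.2.2) := by
        rw [Finset.sum_image hinj]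
    _ ≤ _ := Finset.sum_le_sum_of_subset_of_nonneg (Finset.subset_univ _)
        fun p _ _ => ind_nonneg _

lemma cube_max (q d M L κ : ℝ) (hq : 0 ≤ q) (hd : 0 ≤ d) (hqd : q + d ≤ M) (hM : 0 < M)
    (hL : 0 < L) (hκ : 0 < κ) (h : L * (M ^ 3 - q ^ 3 - d ^ 3) ≤ κ * M ^ 3) :
    (1 - κ / L) * M ≤ q ∨ (1 - κ / L) * M ≤ d := by
  by_contra hcon
  push Not at hcon
  obtain ⟨h1, h2⟩ := hcon
  have hfin : L * (((1 - κ / L) * M) * M * M) = L * M ^ 3 - κ * M ^ 3 := by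
    field_simp
  have hXM : (1 - κ / L) * M < M := by
    have : 0 < κ / L * M := by positivity
    linarith
  generalize (1 - κ / L) * M = X at *
  have hX0 : 0 < X := lt_of_le_of_lt hq h1
  have q2 : q ^ 2 ≤ X ^ 2 := pow_le_pow_left₀ hq h1.le 2
  have d2 : d ^ 2 ≤ X ^ 2 := pow_le_pow_left₀ hd h2.le 2
  have q3 := mul_le_mul_of_nonneg_left q2 hq
  have d3 := mul_le_mul_of_nonneg_left d2 hd
  have s1 : X ^ 2 * (q + d) ≤ X ^ 2 * M := mul_le_mul_of_nonneg_left hqd (by positivity)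
  have s2 : X * M * X < X * M * M := mul_lt_mul_of_pos_left hXM (by positivity)
  have s3 : q ^ 3 + d ^ 3 < X * M * M := by
    calc q ^ 3 + d ^ 3 = q * q ^ 2 + d * d ^ 2 := by ring
      _ ≤ X ^ 2 * (q + d) := by linarith
      _ < X * M * M := by linarith
  have := mul_lt_mul_of_pos_left s3 hL
  linarith

set_option maxHeartbeats 1000000 in
lemma real_main (n m ℓ L β N3 c6 qs ds : ℝ) (hm : 0 < m) (hℓ : 0 < ℓ) (hβ : 0 < β) (hL : 0 < L)
    (hβℓ : β ≤ ℓ) (hnm : n / 27 ≤ m) (h54 : 54 * L ≤ n) (hLn : ℓ * L ≤ n)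
    (hρ : 3 * L * (ℓ - β) ≤ β) (h3 : 3 * m ≤ L * β)
    (hc1 : 27 * m ^ 3 - 54 * n ^ 2 ≤ c6) (hc2 : n ^ 3 - (n - m) ^ 3 - 54 * n ^ 2 ≤ c6)
    (hc : c6 ≤ ℓ ^ 3 * N3 + 6 * ℓ * n ^ 2)
    (hN : N3 ≤ (m / β) ^ 3 * mx (L / (m / β) - 3) - 1 / 100 * ((m / β) ^ 3 - qs ^ 3 - ds ^ 3))
    (hq : 0 ≤ qs) (hd : 0 ≤ ds) (hqd : qs + ds ≤ m / β) :
    (1 - 15746400 / L) * (m / β) ≤ qs ∨ (1 - 15746400 / L) * (m / β) ≤ ds := by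
  set M := m / β with hM
  have hMpos : 0 < M := by positivity
  have hn : 0 < n := by linarith
  have hML : 3 * M ≤ L := by
    rw [hM, mul_div_assoc', div_le_iff₀ hβ]; linarith
  set B := ℓ * M with hB
  have hBpos : 0 < B := by positivity
  have hmM : m = M * β := by rw [hM]; field_simp
  have hBm : m ≤ B := by rw [hmM, hB]; nlinarith
  have hBm2 : 3 * L * (B - m) ≤ m := by
    have : 3 * L * (B - m) = M * (3 * L * (ℓ - β)) := by rw [hmM, hB]; ring
    rw [this, hmM]
    exact mul_le_mul_of_nonneg_left hρ hMpos.le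
  have hBA : 3 * B ≤ ℓ * L := by rw [hB]; nlinarith
  have hBn : 3 * B ≤ n := hBA.trans hLn
  set A := ℓ * L with hA
  have hmx : ℓ ^ 3 * (M ^ 3 * mx (L / M - 3)) = max (27 * B ^ 3) (B ^ 3 - 3 * B ^ 2 * A + 3 * B * A ^ 2) := by
    unfold mx
    rw [mul_max_of_nonneg _ _ (by positivity), mul_max_of_nonneg _ _ (by positivity)]
    congr 1
    · rw [hB]; ring
    · rw [hB, hA]; field_simp; ring
  have hX : max (27 * B ^ 3) (B ^ 3 - 3 * B ^ 2 * A + 3 * B * A ^ 2) ≤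
      c6 + 54 * n ^ 2 + 9 * n ^ 2 * (B - m) := by
    apply max_le
    · have : 27 * B ^ 3 - 27 * m ^ 3 ≤ 9 * n ^ 2 * (B - m) := by
        have e : 27 * B ^ 3 - 27 * m ^ 3 = 27 * (B ^ 2 + B * m + m ^ 2) * (B - m) := by ring
        rw [e]
        refine mul_le_mul_of_nonneg_right ?_ (by linarith)
        nlinarith
      linarith
    · have e1 : B ^ 3 - 3 * B ^ 2 * A + 3 * B * A ^ 2 ≤ B ^ 3 - 3 * B ^ 2 * n + 3 * B * n ^ 2 := by
        have : B ^ 3 - 3 * B ^ 2 * n + 3 * B * n ^ 2 - (B ^ 3 - 3 * B ^ 2 * A + 3 * B * A ^ 2)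
          = 3 * B * ((n - A) * (n + A - B)) := by ring
        have h2 : 0 ≤ (n - A) * (n + A - B) := mul_nonneg (by linarith) (by linarith)
        have h3 : 0 ≤ 3 * B * ((n - A) * (n + A - B)) := by positivity
        linarith
      have e2 : (B ^ 3 - 3 * B ^ 2 * n + 3 * B * n ^ 2) - (n ^ 3 - (n - m) ^ 3) ≤
          9 * n ^ 2 * (B - m) := by
        have e : (B ^ 3 - 3 * B ^ 2 * n + 3 * B * n ^ 2) - (n ^ 3 - (n - m) ^ 3) =
          ((n - m) ^ 2 + (n - m) * (n - B) + (n - B) ^ 2) * (B - m) := by ring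
        rw [e]
        refine mul_le_mul_of_nonneg_right ?_ (by linarith)
        nlinarith
      linarith
  have hY : 1 / 100 * (ℓ ^ 3 * (M ^ 3 - qs ^ 3 - ds ^ 3)) ≤
      6 * ℓ * n ^ 2 + 54 * n ^ 2 + 9 * n ^ 2 * (B - m) := by
    have h1 := mul_le_mul_of_nonneg_left hN (by positivity : 0 ≤ ℓ ^ 3)
    rw [mul_sub, hmx] at h1
    linarith
  have hZ : L * (6 * ℓ * n ^ 2 + 54 * n ^ 2 + 9 * n ^ 2 * (B - m)) ≤ 8 * n ^ 3 := by
    have hn2 : 0 ≤ n ^ 2 := by positivity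
    have a1 := mul_le_mul_of_nonneg_left hLn hn2
    have a2 := mul_le_mul_of_nonneg_left h54 hn2
    have a3 := mul_le_mul_of_nonneg_left hBm2 hn2
    have a4 : n ^ 2 * (3 * m) ≤ n ^ 2 * n := mul_le_mul_of_nonneg_left (by linarith) hn2
    rw [hA] at a1
    nlinarith
  have hn27 : n ^ 3 ≤ 19683 * B ^ 3 := by
    have : n ≤ 27 * B := by linarith
    have := pow_le_pow_left₀ hn.le this 3
    linarith
  have hW : L * (M ^ 3 - qs ^ 3 - ds ^ 3) ≤ 15746400 * M ^ 3 := by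
    have h1 : ℓ ^ 3 * (L * (M ^ 3 - qs ^ 3 - ds ^ 3)) ≤ ℓ ^ 3 * (15746400 * M ^ 3) := by
      have h2 := mul_le_mul_of_nonneg_left hY hL.le
      have e : B ^ 3 = ℓ ^ 3 * M ^ 3 := by rw [hB]; ring
      rw [e] at hn27
      have e2 : ℓ ^ 3 * (L * (M ^ 3 - qs ^ 3 - ds ^ 3)) =
        100 * (L * (1 / 100 * (ℓ ^ 3 * (M ^ 3 - qs ^ 3 - ds ^ 3)))) := by ring
      rw [e2]
      linarith
    exact le_of_mul_le_mul_left h1 (by positivity)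
  exact cube_max qs ds M L 15746400 hq hd hqd hMpos hL (by norm_num) hW


lemma close_of {n m : ℕ} (ε η : ℝ) (R : Finset (Finset ℕ)) (F : Fin m → Finset (Finset ℕ))
    (hη0 : 0 ≤ η) (hη : 6 * η ≤ ε) (I1 : Finset (Fin m)) (hI : (1 - η) * m ≤ I1.card)
    (h1 : ∀ i ∈ I1, ((R \ F i).card : ℝ) ≤ 5 * η * n ^ 3)
    (h2 : ∀ i, ((R \ F i).card : ℝ) ≤ n ^ 3) :
    IsEpsClose ε (n + m) 4 (HF n (fun _ : Fin m => R)) (HF n F) := by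
  classical
  unfold IsEpsClose
  have a1 : ((HF n (fun _ : Fin m => R) \ HF n F).card : ℝ) ≤ ∑ i, ((R \ F i).card : ℝ) := by
    exact_mod_cast HF_diff R F
  have a2 : ∑ i, ((R \ F i).card : ℝ) ≤
      ∑ i : Fin m, (5 * η * n ^ 3 + if i ∈ I1 then 0 else (n:ℝ) ^ 3) := by
    refine Finset.sum_le_sum fun i _ => ?_
    split_ifs with h
    · have := h1 i h; linarith
    · have := h2 i
      have : 0 ≤ 5 * η * (n:ℝ) ^ 3 := by positivity
      linarith
  have a3 : ∑ i : Fin m, (5 * η * n ^ 3 + if i ∈ I1 then 0 else (n:ℝ) ^ 3) =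
      m * (5 * η * n ^ 3) + (m - I1.card) * n ^ 3 := by
    rw [Finset.sum_add_distrib]
    congr 1
    · simp
    · have : ∀ i : Fin m, (if i ∈ I1 then 0 else (n:ℝ) ^ 3) =
        n ^ 3 - if i ∈ I1 then (n:ℝ) ^ 3 else 0 := fun i => by split_ifs <;> simp
      simp only [this, Finset.sum_sub_distrib]
      simp
      ring
  have a4 : ((m:ℝ) - I1.card) * n ^ 3 ≤ (η * m) * n ^ 3 :=
    mul_le_mul_of_nonneg_right (by linarith) (by positivity)
  have a5 : (m:ℝ) * n ^ 3 ≤ ((n + m : ℕ) : ℝ) ^ 4 := by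
    push_cast
    have h3 : (n:ℝ) ^ 3 ≤ (n + m) ^ 3 := pow_le_pow_left₀ (by positivity) (by
      have : (0:ℝ) ≤ m := by positivity
      linarith) 3
    have h4 : (m:ℝ) ≤ n + m := by
      have : (0:ℝ) ≤ n := by positivity
      linarith
    calc (m:ℝ) * n ^ 3 ≤ (n + m) * (n + m) ^ 3 := mul_le_mul h4 h3 (by positivity) (by positivity)
      _ = _ := by ring
  have a6 : 6 * η * ((m:ℝ) * n ^ 3) ≤ ε * ((n + m : ℕ) : ℝ) ^ 4 :=
    mul_le_mul hη a5 (by positivity) (by linarith)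
  linarith

lemma load_bound {I V : Type*} [Fintype I] [Fintype V] [DecidableEq V]
    (z : I → (Fin 3 → V) → ℝ) (β : ℝ) (z1 : ∀ i e, 0 ≤ z i e) (U : Finset V)
    (hU : ∀ a ∈ U, β ≤ loadz z a) (b : (Fin 3 → V) → ℝ)
    (hb : ∀ i e, z i e ≠ 0 → ∑ k, (if e k ∈ U then (1:ℝ) else 0) ≤ b e) :
    β * U.card ≤ ∑ i, ∑ e, z i e * b e := by
  have h1 : ∑ a ∈ U, β ≤ ∑ a ∈ U, loadz z a := Finset.sum_le_sum hU
  rw [Finset.sum_const, nsmul_eq_mul] at h1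
  have h2 : ∑ a ∈ U, loadz z a = ∑ i, ∑ e, z i e * ∑ a ∈ U, cnt e a := by
    unfold loadz
    rw [Finset.sum_comm]
    refine Finset.sum_congr rfl fun i _ => ?_
    rw [Finset.sum_comm]
    refine Finset.sum_congr rfl fun e _ => ?_
    rw [Finset.mul_sum]
  have h3 : ∀ e : Fin 3 → V, ∑ a ∈ U, cnt e a = ∑ k, (if e k ∈ U then (1:ℝ) else 0) := by
    intro e
    unfold cnt
    rw [Finset.sum_comm]
    refine Finset.sum_congr rfl fun k _ => ?_
    rw [Finset.sum_ite_eq]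
  have h4 : ∑ i, ∑ e, z i e * ∑ a ∈ U, cnt e a ≤ ∑ i, ∑ e, z i e * b e := by
    refine Finset.sum_le_sum fun i _ => Finset.sum_le_sum fun e _ => ?_
    rw [h3]
    by_cases hz : z i e = 0
    · rw [hz, zero_mul, zero_mul]
    · exact mul_le_mul_of_nonneg_left (hb i e hz) (z1 i e)
  linarith

lemma I1_bound {I E : Type*} [Fintype I] [Fintype E] (z : I → E → ℝ) (z1 : ∀ i e, 0 ≤ z i e)
    (z2 : ∀ i, ∑ e, z i e = 1) (g : E → ℝ) (hg : ∀ e, g e ≤ 1) (I1 : Finset I)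
    (h : ∀ i e, z i e ≠ 0 → g e ≠ 0 → i ∈ I1) : ∑ i, ∑ e, z i e * g e ≤ I1.card := by
  classical
  have : ∀ i, ∑ e, z i e * g e ≤ if i ∈ I1 then (1:ℝ) else 0 := by
    intro i
    split_ifs with hi
    · rw [← z2 i]
      refine Finset.sum_le_sum fun e _ => ?_
      have := mul_le_mul_of_nonneg_left (hg e) (z1 i e)
      linarith
    · apply le_of_eq
      refine Finset.sum_eq_zero fun e _ => ?_
      by_contra hne
      exact hi (h i e (left_ne_zero_of_mul hne) (right_ne_zero_of_mul hne))
  refine (Finset.sum_le_sum fun i _ => this i).trans ?_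
  simp

lemma natsub_le {a b : ℕ} {c : ℝ} (hc : 0 ≤ c) (h : (a:ℝ) ≤ b + c) : ((a - b : ℕ) : ℝ) ≤ c := by
  rcases le_total a b with h1 | h1
  · rw [Nat.sub_eq_zero_of_le h1]; simpa using hc
  · rw [Nat.cast_sub h1]; linarith

lemma sT_ne {x : Fin 3 → ℝ} (h : sT x ≠ 0) : ∃ k, 1 ≤ x k := by
  by_contra h'
  exact h (by unfold sT; rw [if_neg h'])

lemma dT_ne {x : Fin 3 → ℝ} (h : dT x ≠ 0) : ∀ k, x k = 1 / 3 := by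
  by_contra h'
  exact h (by unfold dT; rw [if_neg h'])

lemma sT_eq {x : Fin 3 → ℝ} (h : sT x ≠ 0) : sT x = 1 := by
  have h' := sT_ne h
  unfold sT; rw [if_pos h']

lemma dT_eq {x : Fin 3 → ℝ} (h : dT x ≠ 0) : dT x = 1 := by
  have h' := dT_ne h
  unfold dT; rw [if_pos h']

lemma sT_dT (x : Fin 3 → ℝ) : sT x + dT x ≤ 1 := by
  by_cases h : sT x = 0
  · have := dT_le x; rw [h]; linarith
  · by_cases h' : dT x = 0
    · have := sT_le x; rw [h']; linarith
    · obtain ⟨k, hk⟩ := sT_ne h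
      have := dT_ne h' k
      rw [this] at hk
      norm_num at hk

lemma sum3_ite_le {V : Type*} [DecidableEq V] (U : Finset V) (e : Fin 3 → V) :
    ∑ k, (if e k ∈ U then (1:ℝ) else 0) ≤ 3 := by
  refine (Finset.sum_le_sum (g := fun _ => (1:ℝ)) fun k _ => ?_).trans ?_
  · split_ifs <;> norm_num
  · simp

/-- the alternative produced by the fractional relaxation -/
lemma core_alt {n m ℓ L : ℕ} (β : ℝ) (F : Fin m → Finset (Finset ℕ))
    (hℓ : 0 < ℓ) (hm : 0 < m) (hβ : 0 < β) (hL : 0 < L) (hβℓ : β ≤ ℓ)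
    (hnm : (n:ℝ) / 27 ≤ m) (hmn : 3 * m ≤ n) (h54 : 54 * (L:ℝ) ≤ n) (hLn : L * ℓ ≤ n)
    (hn' : n < (L + 1) * ℓ)
    (hρ : 3 * L * (ℓ - β) ≤ β) (h3 : 3 * m ≤ L * β)
    (hK : ∀ i, IsKGraphOn n 3 (F i)) (hF : ∀ i, StableGraph n (F i))
    (hf : ∀ i, (F i).card > fEMC n m 3)
    (z : Fin m → (Fin 3 → Fin L) → ℝ) (z1 : ∀ i e, 0 ≤ z i e) (z2 : ∀ i, ∑ e, z i e = 1)
    (w : Fin L → ℝ) (w0 : ∀ a, 0 ≤ w a) (w1 : ∀ a, 0 < w a → β ≤ loadz z a)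
    (w2 : ∀ i e, z i e ≠ 0 → ∑ k, w (e k) ≤ 1)
    (w3 : ∃ i, ∀ e ∈ GB ℓ L (F i), 1 ≤ ∑ k, w (e k)) :
    (1 - 15746400 / L) * m ≤ ∑ i, ∑ e, z i e * sT (fun k => w (e k)) ∨
    (1 - 15746400 / L) * m ≤ ∑ i, ∑ e, z i e * dT (fun k => w (e k)) := by
  have hmR : (0:ℝ) < m := by exact_mod_cast hm
  have hLR : (0:ℝ) < L := by exact_mod_cast hL
  have hLnR : (ℓ:ℝ) * L ≤ n := by rw [mul_comm]; exact_mod_cast hLn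
  obtain ⟨i0, hi0⟩ := w3
  have conv : ∀ g : (Fin 3 → Fin L) → ℝ,
      ∑ j : Fin m × (Fin 3 → Fin L), z j.1 j.2 / β * g j.2 = (∑ i, ∑ e, z i e * g e) / β := by
    intro g
    rw [Fintype.sum_prod_type, Finset.sum_div]
    refine Finset.sum_congr rfl fun i _ => ?_
    rw [Finset.sum_div]
    refine Finset.sum_congr rfl fun e _ => ?_
    ring
  have hM : ∑ j : Fin m × (Fin 3 → Fin L), z j.1 j.2 / β = (m:ℝ) / β := by
    have := conv (fun _ => 1)
    simp only [mul_one] at this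
    rw [this]
    congr 1
    simp [z2]
  have hMpos : 0 < (m:ℝ) / β := by positivity
  have CC := count_core w w0 (fun j : Fin m × (Fin 3 → Fin L) => j.2) (fun j => z j.1 j.2 / β)
    (fun j => div_nonneg (z1 _ _) hβ.le) (m / β) (L / (m / β) - 3) hM
    (by rw [Fintype.card_fin]; field_simp)
    (by
      rw [sub_nonneg, le_div_iff₀ hMpos, mul_div_assoc', div_le_iff₀ hβ]
      linarith)
    (by
      intro a ha
      have h1 := conv (fun e => ∑ k, (if e k = a then (1:ℝ) else 0))
      rw [h1, le_div_iff₀ hβ, one_mul]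
      exact w1 a ha)
    (by
      intro j hj
      refine w2 j.1 j.2 ?_
      intro h
      exact hj (by rw [h, zero_div]))
  have hcG := count_GB (L := L) hℓ hn' (hF i0) (hK i0)
  have hcN := card_le_N3 w (GB ℓ L (F i0)) hi0
  have hfl := f_lower hm hmn (hf i0)
  have q1 := conv (fun e => sT (fun k => w (e k)))
  have q2 := conv (fun e => dT (fun k => w (e k)))
  have hcR : 6 * ((F i0).card : ℝ) ≤ ℓ ^ 3 * (∑ a, ∑ b, ∑ c, ind (w a + w b + w c))
      + 6 * ℓ * n ^ 2 := by
    have h1 : 6 * ((F i0).card : ℝ) ≤ ℓ ^ 3 * ((GB ℓ L (F i0)).card : ℝ) + 6 * ℓ * n ^ 2 := by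
      exact_mod_cast hcG
    have := mul_le_mul_of_nonneg_left hcN (by positivity : (0:ℝ) ≤ (ℓ:ℝ) ^ 3)
    linarith
  have S0 : 0 ≤ ∑ i, ∑ e, z i e * sT (fun k => w (e k)) :=
    Finset.sum_nonneg fun i _ => Finset.sum_nonneg fun e _ => mul_nonneg (z1 i e) (sT_nonneg _)
  have D0 : 0 ≤ ∑ i, ∑ e, z i e * dT (fun k => w (e k)) :=
    Finset.sum_nonneg fun i _ => Finset.sum_nonneg fun e _ => mul_nonneg (z1 i e) (dT_nonneg _)
  have SD : ∑ i, ∑ e, z i e * sT (fun k => w (e k)) + ∑ i, ∑ e, z i e * dT (fun k => w (e k))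
      ≤ m := by
    have : (m:ℝ) = ∑ i, ∑ e, z i e := by simp [z2]
    rw [this]
    simp only [← Finset.sum_add_distrib]
    refine Finset.sum_le_sum fun i _ => Finset.sum_le_sum fun e _ => ?_
    rw [← mul_add]
    have := mul_le_mul_of_nonneg_left (sT_dT (fun k => w (e k))) (z1 i e)
    linarith
  rw [q1, q2] at CC
  have RM := real_main n m ℓ L β _ _ _ _ hmR (by exact_mod_cast hℓ) hβ hLR hβℓ hnm h54 hLnR hρ h3
    hfl.1 hfl.2 hcR CC (by positivity) (by positivity) (by
      rw [← add_div]; exact div_le_div_of_nonneg_right SD hβ.le)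
  rw [mul_div_assoc'] at RM
  rcases RM with h | h
  · left; exact (div_le_div_iff_of_pos_right hβ).1 h
  · right; exact (div_le_div_iff_of_pos_right hβ).1 h


lemma kl_bound {k X ℓ β δ : ℝ} (hk : 0 ≤ k) (hδ : 0 ≤ δ) (h : β * k ≤ X)
    (hl : ℓ - β ≤ β * δ / 3) : k * ℓ ≤ X + X * δ / 3 := by
  have h1 := mul_le_mul_of_nonneg_left hl hk
  have h2 := mul_le_mul_of_nonneg_right h hδ
  nlinarith

lemma core_S {n m ℓ L : ℕ} (β ε δ : ℝ) (F : Fin m → Finset (Finset ℕ))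
    (hℓ : 0 < ℓ) (hm : 0 < m) (hmn : 3 * m ≤ n) (hn' : n < (L + 1) * ℓ) (hδ0 : 0 < δ)
    (hδ1 : δ ≤ 1) (hδβ : ℓ - β ≤ β * δ / 3) (hδℓ : ℓ ≤ δ * n) (hδn : 1 ≤ δ * n)
    (hε : 6 * (15746400 * δ) ≤ ε) (hLn : L * ℓ ≤ n)
    (hK : ∀ i, IsKGraphOn n 3 (F i)) (hF : ∀ i, StableGraph n (F i))
    (hf : ∀ i, (F i).card > fEMC n m 3)
    (z : Fin m → (Fin 3 → Fin L) → ℝ) (z1 : ∀ i e, 0 ≤ z i e) (z2 : ∀ i, ∑ e, z i e = 1)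
    (w : Fin L → ℝ) (w0 : ∀ a, 0 ≤ w a) (w1 : ∀ a, 0 < w a → β ≤ loadz z a)
    (w2 : ∀ i e, z i e ≠ 0 → ∑ k, w (e k) ≤ 1)
    (w4 : ∀ i e, z i e ≠ 0 → 1 ≤ ∑ k, w (e k) → ∀ e' ∈ GB ℓ L (F i), 1 ≤ ∑ k, w (e' k))
    (hS : (1 - 15746400 * δ) * m ≤ ∑ i, ∑ e, z i e * sT (fun k => w (e k))) :
    IsEpsClose ε (n + m) 4 (HS n m 3) (HF n F) := by
  classical
  have hmnR : 3 * (m:ℝ) ≤ n := by exact_mod_cast hmn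
  have hm0 : (0:ℝ) ≤ m := by positivity
  have hn0 : (0:ℝ) ≤ n := by positivity
  set I1 : Finset (Fin m) := Finset.univ.filter (fun i => ∀ e ∈ GB ℓ L (F i), 1 ≤ ∑ k, w (e k))
    with hI1
  set U : Finset (Fin L) := Finset.univ.filter (fun a => 0 < w a) with hU
  have hI : (1 - 15746400 * δ) * m ≤ I1.card := by
    refine hS.trans (I1_bound z z1 z2 _ (fun e => sT_le _) I1 ?_)
    intro i e hz hs
    obtain ⟨k, hk⟩ := sT_ne hs
    rw [hI1, Finset.mem_filter]
    refine ⟨Finset.mem_univ _, w4 i e hz (hk.trans ?_)⟩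
    exact Finset.single_le_sum (f := fun k => w (e k)) (fun k _ => w0 (e k)) (Finset.mem_univ k)
  have hUc : β * U.card ≤ m * (1 + 3 * (15746400 * δ)) := by
    have h1 := load_bound z β z1 U (fun a ha => w1 a (Finset.mem_filter.1 ha).2)
      (fun e => 4 - 3 * sT (fun k => w (e k))) (by
        intro i e hz
        by_cases hs : sT (fun k => w (e k)) = 0
        · have := sum3_ite_le U e
          simp only [hs]; linarith
        · simp only [sT_eq hs]
          obtain ⟨k, hk⟩ := sT_ne hs
          have h5 := w2 i e hz
          calc ∑ j, (if e j ∈ U then (1:ℝ) else 0) ≤ ∑ j, if j = k then (1:ℝ) else 0 := by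
                refine Finset.sum_le_sum fun j _ => ?_
                by_cases hj : j = k
                · rw [if_pos hj]; split_ifs <;> norm_num
                · rw [if_neg hj, if_neg]
                  intro hjU
                  have h6 := (Finset.mem_filter.1 hjU).2
                  rw [← Finset.add_sum_erase _ _ (Finset.mem_univ k)] at h5
                  have h7 := Finset.single_le_sum (f := fun k => w (e k)) (fun k _ => w0 (e k))
                    (Finset.mem_erase.2 ⟨hj, Finset.mem_univ j⟩)
                  linarith
            _ ≤ _ := by simp; norm_num)
    have h2 : ∑ i, ∑ e, z i e * (4 - 3 * sT (fun k => w (e k))) =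
        4 * m - 3 * ∑ i, ∑ e, z i e * sT (fun k => w (e k)) := by
      have : ∀ i e, z i e * (4 - 3 * sT (fun k => w (e k))) =
        4 * z i e - 3 * (z i e * sT (fun k => w (e k))) := fun i e => by ring
      simp only [this, Finset.sum_sub_distrib, ← Finset.mul_sum, z2]
      simp
    rw [h2] at h1
    linarith
  have hkl := kl_bound (ℓ := (ℓ:ℝ)) (by positivity) hδ0.le hUc hδβ
  have hη0 : 0 ≤ 15746400 * δ := by positivity
  refine close_of ε (15746400 * δ) _ F hη0 hε I1 hI ?_ ?_
  · intro i hi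
    have hi' := (Finset.mem_filter.1 hi).2
    have h1 : (SGraph n m 3 \ F i).card ≤ (F i \ SGraph n m 3).card := by
      rw [Finset.card_sdiff_le_card_sdiff_iff]
      have h2 := card_SG hm (by omega : m ≤ n)
      have h3 := hf i
      unfold fEMC at h3
      have h4 := (max_lt_iff.1 h3).1
      omega
    have h2 := S_case (m := m) hℓ hn' (hF i) (hK i) (S_struct (GB ℓ L (F i))
      (fun e he => (mem_GB.1 he).1) (fun e he c hc hce => GB_dom hℓ hLn (hF i) he hc hce)
      w hi' U (fun a ha => by
        by_contra h
        push Not at h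
        exact ha (Finset.mem_filter.2 ⟨Finset.mem_univ _, h⟩)))
    have h3 : (((U.card + 1) * ℓ + 1 - m : ℕ) : ℝ) ≤ 3 * (15746400 * δ) * n := by
      refine natsub_le (by positivity) ?_
      push_cast
      have e1 : m * δ ≤ n / 3 * δ := mul_le_mul_of_nonneg_right (by linarith) hδ0.le
      have e2 : m * δ * δ ≤ m * δ * 1 := mul_le_mul_of_nonneg_left hδ1 (by positivity)
      nlinarith
    have h4 : 6 * ((F i \ SGraph n m 3).card : ℝ) ≤ 6 * ℓ * n ^ 2 +
        3 * (((U.card + 1) * ℓ + 1 - m : ℕ) : ℝ) * n ^ 2 := by exact_mod_cast h2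
    have h5 := mul_le_mul_of_nonneg_right h3 (by positivity : (0:ℝ) ≤ (n:ℝ) ^ 2)
    have h6 := mul_le_mul_of_nonneg_right hδℓ (by positivity : (0:ℝ) ≤ (n:ℝ) ^ 2)
    have h7 : ((SGraph n m 3 \ F i).card : ℝ) ≤ (F i \ SGraph n m 3).card := by exact_mod_cast h1
    have h8 : 0 ≤ δ * (n:ℝ) ^ 3 := by positivity
    nlinarith
  · intro i
    have h1 : (SGraph n m 3 \ F i).card ≤ n ^ 3 := by
      refine (Finset.card_le_card Finset.sdiff_subset).trans ?_
      refine (card_SG hm (by omega : m ≤ n)).trans ((Nat.sub_le _ _).trans (Nat.choose_le_pow _ _))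
    exact_mod_cast h1

lemma core_D {n m ℓ L : ℕ} (β ε δ : ℝ) (F : Fin m → Finset (Finset ℕ))
    (hℓ : 0 < ℓ) (hmn : 3 * m ≤ n) (hn' : n < (L + 1) * ℓ) (hδ0 : 0 < δ)
    (hδ1 : δ ≤ 1) (hδβ : ℓ - β ≤ β * δ / 3) (hδℓ : ℓ ≤ δ * n) (hδn : 1 ≤ δ * n)
    (hε : 6 * (15746400 * δ) ≤ ε) (hLn : L * ℓ ≤ n)
    (hK : ∀ i, IsKGraphOn n 3 (F i)) (hF : ∀ i, StableGraph n (F i))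
    (hf : ∀ i, (F i).card > fEMC n m 3)
    (z : Fin m → (Fin 3 → Fin L) → ℝ) (z1 : ∀ i e, 0 ≤ z i e) (z2 : ∀ i, ∑ e, z i e = 1)
    (w : Fin L → ℝ) (w1 : ∀ a, 0 < w a → β ≤ loadz z a)
    (w4 : ∀ i e, z i e ≠ 0 → 1 ≤ ∑ k, w (e k) → ∀ e' ∈ GB ℓ L (F i), 1 ≤ ∑ k, w (e' k))
    (hD : (1 - 15746400 * δ) * m ≤ ∑ i, ∑ e, z i e * dT (fun k => w (e k))) :
    IsEpsClose ε (n + m) 4 (HD n m 3) (HF n F) := by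
  classical
  have hmnR : 3 * (m:ℝ) ≤ n := by exact_mod_cast hmn
  have hm0 : (0:ℝ) ≤ m := by positivity
  have hn0 : (0:ℝ) ≤ n := by positivity
  set I1 : Finset (Fin m) := Finset.univ.filter (fun i => ∀ e ∈ GB ℓ L (F i), 1 ≤ ∑ k, w (e k))
    with hI1
  set U : Finset (Fin L) := Finset.univ.filter (fun a => 0 < w a) with hU
  set W : Finset (Fin L) := Finset.univ.filter (fun a => 0 < w a ∧ w a ≠ 1 / 3) with hW
  have hI : (1 - 15746400 * δ) * m ≤ I1.card := by
    refine hD.trans (I1_bound z z1 z2 _ (fun e => dT_le _) I1 ?_)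
    intro i e hz hs
    have hk := dT_ne hs
    rw [hI1, Finset.mem_filter]
    refine ⟨Finset.mem_univ _, w4 i e hz ?_⟩
    rw [Finset.sum_congr rfl fun k _ => hk k]
    simp
  have hUc : β * U.card ≤ 3 * m := by
    have h1 := load_bound z β z1 U (fun a ha => w1 a (Finset.mem_filter.1 ha).2)
      (fun e => 3) (fun i e _ => sum3_ite_le U e)
    simp only [← Finset.sum_mul, z2] at h1
    simp at h1
    linarith
  have hWc : β * W.card ≤ m * (3 * (15746400 * δ)) := by
    have h1 := load_bound z β z1 W (fun a ha => w1 a (Finset.mem_filter.1 ha).2.1)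
      (fun e => 3 - 3 * dT (fun k => w (e k))) (by
        intro i e hz
        by_cases hs : dT (fun k => w (e k)) = 0
        · have := sum3_ite_le W e
          simp only [hs]; linarith
        · simp only [dT_eq hs]
          have hk := dT_ne hs
          rw [Finset.sum_eq_zero]
          · norm_num
          · intro k _
            rw [if_neg]
            intro h
            exact (Finset.mem_filter.1 h).2.2 (hk k))
    have h2 : ∑ i, ∑ e, z i e * (3 - 3 * dT (fun k => w (e k))) =
        3 * m - 3 * ∑ i, ∑ e, z i e * dT (fun k => w (e k)) := by
      have : ∀ i e, z i e * (3 - 3 * dT (fun k => w (e k))) =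
        3 * z i e - 3 * (z i e * dT (fun k => w (e k))) := fun i e => by ring
      simp only [this, Finset.sum_sub_distrib, ← Finset.mul_sum, z2]
      simp
    rw [h2] at h1
    linarith
  have hkl := kl_bound (ℓ := (ℓ:ℝ)) (by positivity) hδ0.le hUc hδβ
  have hkl' := kl_bound (ℓ := (ℓ:ℝ)) (by positivity) hδ0.le hWc hδβ
  have hη0 : 0 ≤ 15746400 * δ := by positivity
  have e1 : m * δ ≤ n / 3 * δ := mul_le_mul_of_nonneg_right (by linarith) hδ0.le
  have e2 : m * δ * δ ≤ m * δ * 1 := mul_le_mul_of_nonneg_left hδ1 (by positivity)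
  refine close_of ε (15746400 * δ) _ F hη0 hε I1 hI ?_ ?_
  · intro i hi
    have hi' := (Finset.mem_filter.1 hi).2
    have h1 : (DGraph n m 3 \ F i).card ≤ (F i \ DGraph n m 3).card := by
      rw [Finset.card_sdiff_le_card_sdiff_iff]
      have h2 := card_DG n m
      have h3 := hf i
      unfold fEMC at h3
      have h4 := (max_lt_iff.1 h3).2
      omega
    have h2 := D_case (m := m) hℓ hn' (hF i) (hK i) (D_struct (GB ℓ L (F i))
      (fun e he c hc hce => GB_dom hℓ hLn (hF i) he hc hce)
      w hi' U W (fun a ha => by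
        by_contra h
        push Not at h
        exact ha (Finset.mem_filter.2 ⟨Finset.mem_univ _, h⟩)) (fun a ha => by
        by_contra h
        push Not at h
        exact ha (Finset.mem_filter.2 ⟨Finset.mem_univ _, by linarith, by linarith⟩)))
    have h3 : (((U.card + W.card + 2 + 1) * ℓ + 1 - 3 * m : ℕ) : ℝ) ≤
        4 * (15746400 * δ) * n := by
      refine natsub_le (by positivity) ?_
      push_cast
      nlinarith
    have h3' : (((W.card + 1 + 1) * ℓ : ℕ) : ℝ) ≤ 4 * (15746400 * δ) * n := by
      push_cast
      nlinarith
    have h4 : 6 * ((F i \ DGraph n m 3).card : ℝ) ≤ 6 * ℓ * n ^ 2 +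
        (3 * (((W.card + 1 + 1) * ℓ : ℕ) : ℝ) * n ^ 2 +
        3 * (((U.card + W.card + 2 + 1) * ℓ + 1 - 3 * m : ℕ) : ℝ) * n ^ 2) := by
      exact_mod_cast h2
    have h5 := mul_le_mul_of_nonneg_right h3 (by positivity : (0:ℝ) ≤ (n:ℝ) ^ 2)
    have h5' := mul_le_mul_of_nonneg_right h3' (by positivity : (0:ℝ) ≤ (n:ℝ) ^ 2)
    have h6 := mul_le_mul_of_nonneg_right hδℓ (by positivity : (0:ℝ) ≤ (n:ℝ) ^ 2)
    have h7 : ((DGraph n m 3 \ F i).card : ℝ) ≤ (F i \ DGraph n m 3).card := by exact_mod_cast h1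
    have h8 : 0 ≤ δ * (n:ℝ) ^ 3 := by positivity
    generalize (((U.card + W.card + 2 + 1) * ℓ + 1 - 3 * m : ℕ) : ℝ) = Q1 at *
    generalize (((W.card + 1 + 1) * ℓ : ℕ) : ℝ) = Q2 at *
    have g5 : 4 * (15746400 * δ) * n * n ^ 2 = 4 * 15746400 * (δ * n ^ 3) := by ring
    have g6 : δ * n * n ^ 2 = δ * (n:ℝ) ^ 3 := by ring
    have g7 : 5 * (15746400 * δ) * n ^ 3 = 5 * 15746400 * (δ * (n:ℝ) ^ 3) := by ring
    rw [g7]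
    linarith
  · intro i
    have h1 : (DGraph n m 3 \ F i).card ≤ n ^ 3 := by
      refine (Finset.card_le_card Finset.sdiff_subset).trans ?_
      rw [card_DG]
      exact (Nat.choose_le_pow _ _).trans (Nat.pow_le_pow_left (by omega) _)
    exact_mod_cast h1

/-- the non-extremal case — if `H(F)` is close to neither
`H_S(n,m,3)` nor `H_D(n,m,3)`, then `F` admits a rainbow matching. -/
theorem non_extremal_rainbow :
    ∃ c₀ : ℝ, 0 < c₀ ∧ ∀ c : ℝ, 0 < c → c < c₀ →
      ∃ ε₀ : ℝ, 0 < ε₀ ∧ ∀ ε : ℝ, 0 < ε → ε < ε₀ →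
        ∃ n₀ : ℕ, ∀ n : ℕ, n ≥ n₀ → ∀ m : ℕ, 0 < m →
          (n : ℝ) / 27 < (m : ℝ) → (m : ℝ) < (1 - c) * n / 3 →
          ∀ F : Fin m → Finset (Finset ℕ), (∀ i, IsKGraphOn n 3 (F i)) →
            (∀ i, StableGraph n (F i)) → (∀ i, (F i).card > fEMC n m 3) →
            (∀ i, ∀ v ∈ Finset.Icc 1 n,
              degOf (F i) v ≤ Nat.choose (n - 1) 2 - Nat.choose (n - 3 * (m - 1) - 1) 2) →
            ¬ IsEpsClose ε (n + m) 4 (HS n m 3) (HF n F) →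
            ¬ IsEpsClose ε (n + m) 4 (HD n m 3) (HF n F) →
            HasRainbowMatching F := by
  refine ⟨1, one_pos, fun c hc0 _ => ⟨1, one_pos, fun ε hε0 hε1 => ?_⟩⟩
  set L : ℕ := ⌈(10:ℝ) ^ 8 / ε⌉₊ + 1 with hLdef
  have hL : 0 < L := Nat.succ_pos _
  have hLR : (0:ℝ) < L := by exact_mod_cast hL
  have hLε : (10:ℝ) ^ 8 ≤ L * ε := by
    have h1 := Nat.le_ceil ((10:ℝ) ^ 8 / ε)
    have h2 : (10:ℝ) ^ 8 / ε ≤ L := by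
      rw [hLdef]; push_cast; linarith
    rwa [div_le_iff₀ hε0] at h2
  clear_value L
  set K0 : ℕ := Fintype.card (Finset (Fin 3 → Fin L)) * Fintype.card (Fin 3 → Fin L) with hK0
  have hK0pos : 0 < K0 := by
    have : Nonempty (Fin L) := ⟨⟨0, hL⟩⟩
    exact Nat.mul_pos Fintype.card_pos Fintype.card_pos
  set K : ℕ := 3 * K0 with hKdef
  refine ⟨⌈((L:ℝ) + L * K) / c⌉₊ + L * (K + 3 * L * K + 1) + 54 * L + 100000 * L, ?_⟩
  intro n hn m hm hnm hmc F hKG hF hf _ hnS hnD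
  have hcn : (L:ℝ) + L * K ≤ c * n := by
    have h1 := Nat.le_ceil (((L:ℝ) + L * K) / c)
    have h2 : ((⌈((L:ℝ) + L * K) / c⌉₊ : ℕ) : ℝ) ≤ n := by
      exact_mod_cast (by omega : ⌈((L:ℝ) + L * K) / c⌉₊ ≤ n)
    have h3 := h1.trans h2
    rw [div_le_iff₀ hc0] at h3
    linarith
  have hn1 : L * (K + 3 * L * K + 1) ≤ n := by omega
  have hn2 : 54 * L ≤ n := by omega
  have hn2R : 54 * (L:ℝ) ≤ n := by exact_mod_cast hn2
  clear hn
  set ℓ : ℕ := n / L with hℓdef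
  have hLn : L * ℓ ≤ n := Nat.mul_div_le n L
  have hLn2 : n < L * (ℓ + 1) := by
    have := Nat.lt_mul_div_succ n hL
    exact this
  have hℓ1 : K + 3 * L * K + 1 ≤ ℓ := by
    rw [hℓdef, Nat.le_div_iff_mul_le hL, mul_comm]; exact hn1
  have hℓ : 0 < ℓ := by omega
  have hLℓ : L ≤ ℓ := by
    have : L * 1 ≤ L * K := Nat.mul_le_mul_left _ (by omega)
    have h2 : 3 * L * K = 3 * (L * K) := by ring
    omega
  have hn' : n < (L + 1) * ℓ := by
    have h1 : L * (ℓ + 1) = L * ℓ + L := by ring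
    have h2 : (L + 1) * ℓ = L * ℓ + ℓ := by ring
    omega
  clear_value ℓ
  have hℓ1R : (K:ℝ) + 3 * L * K + 1 ≤ ℓ := by exact_mod_cast hℓ1
  have hLn2R : (n:ℝ) < L * (ℓ + 1) := by exact_mod_cast hLn2
  have hLnR : (L:ℝ) * ℓ ≤ n := by exact_mod_cast hLn
  have hKR : (0:ℝ) ≤ K := by positivity
  have hn0 : (0:ℝ) ≤ n := by positivity
  set β : ℝ := ℓ - K with hβdef
  have hLK : (0:ℝ) ≤ 3 * L * K := by positivity
  have hβ : 0 < β := by rw [hβdef]; linarith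
  have hβℓ : β ≤ ℓ := by rw [hβdef]; linarith
  have h3 : 3 * (m:ℝ) ≤ L * β := by
    rw [hβdef]
    have : (1 - c) * (n:ℝ) = n - c * n := by ring
    have e2 : (L:ℝ) * (ℓ - K) = L * (ℓ + 1) - (L + L * K) := by ring
    linarith
  have hmnR : 3 * (m:ℝ) ≤ n := by
    have : (L:ℝ) * β ≤ L * ℓ := mul_le_mul_of_nonneg_left hβℓ hLR.le
    linarith
  have hmn : 3 * m ≤ n := by exact_mod_cast hmnR
  have hρ : 3 * (L:ℝ) * (ℓ - β) ≤ β := by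
    have : (ℓ:ℝ) - β = K := by rw [hβdef]; ring
    rw [this, hβdef]; linarith
  have hGne : ∀ i, (GB ℓ L (F i)).Nonempty := by
    intro i
    by_contra hemp
    rw [Finset.not_nonempty_iff_eq_empty] at hemp
    have h1 := count_GB (L := L) hℓ hn' (hF i) (hKG i)
    rw [hemp, Finset.card_empty, mul_zero, zero_add] at h1
    have h1R : 6 * ((F i).card : ℝ) ≤ 6 * ℓ * n ^ 2 := by exact_mod_cast h1
    have h2 := (f_lower hm hmn (hf i)).1
    have hnpos : (0:ℝ) < n := by linarith
    have hLbig : (10:ℝ) ^ 8 ≤ L := by nlinarith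
    have h4 : (n:ℝ) ^ 3 ≤ 19683 * (m:ℝ) ^ 3 := by
      have a1 : (n:ℝ) ≤ 27 * m := by linarith
      have := pow_le_pow_left₀ hnpos.le a1 3
      linarith
    have h5 : (n:ℝ) * n ^ 2 ≤ (729 * (6 * ℓ + 54)) * n ^ 2 := by
      have : (n:ℝ) * n ^ 2 = n ^ 3 := by ring
      linarith
    have h6 : (n:ℝ) ≤ 729 * (6 * ℓ + 54) := le_of_mul_le_mul_right h5 (by positivity)
    have hℓ0 : (0:ℝ) ≤ ℓ := by positivity
    have h7 : (10:ℝ) ^ 8 * ℓ ≤ L * ℓ := mul_le_mul_of_nonneg_right hLbig hℓ0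
    linarith
  obtain ⟨z, z1, z2, z3, z4⟩ := frac_opt β (fun i => GB ℓ L (F i)) hGne
  by_cases hbig : ∃ a, β < loadz z a
  · exfalso
    obtain ⟨w, w0, w1, w2, w3, w4⟩ := dual_struct β hβ _ z z1 z2 z3 z4 hbig
    have alt := core_alt β F hℓ hm hβ hL hβℓ hnm.le hmn hn2R hLn hn' hρ h3 hKG hF hf
      z z1 z2 w w0 w1 w2 w3
    rw [div_eq_mul_one_div] at alt
    have hδ1 : 1 / (L:ℝ) ≤ 1 := by
      rw [div_le_one hLR]; exact_mod_cast hL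
    have hδβ : (ℓ:ℝ) - β ≤ β * (1 / (L:ℝ)) / 3 := by
      rw [mul_one_div, div_div, le_div_iff₀ (by positivity)]
      linarith
    have hδℓ : (ℓ:ℝ) ≤ 1 / (L:ℝ) * n := by
      rw [one_div_mul_eq_div, le_div_iff₀ hLR]; linarith
    have hδn : (1:ℝ) ≤ 1 / (L:ℝ) * n := by
      rw [one_div_mul_eq_div, le_div_iff₀ hLR]; linarith
    have hδε : 6 * (15746400 * (1 / (L:ℝ))) ≤ ε := by
      have : 6 * (15746400 * (1 / (L:ℝ))) = 94478400 / L := by ring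
      rw [this, div_le_iff₀ hLR]
      linarith
    rcases alt with h | h
    · exact hnS (core_S β ε (1 / (L:ℝ)) F hℓ hm hmn hn' (by positivity) hδ1 hδβ hδℓ hδn hδε hLn
        hKG hF hf z z1 z2 w w0 w1 w2 w4 h)
    · exact hnD (core_D β ε (1 / (L:ℝ)) F hℓ hmn hn' (by positivity) hδ1 hδβ hδℓ hδn hδε hLn
        hKG hF hf z z1 z2 w w1 w4 h)
  · push Not at hbig
    obtain ⟨f, f1, f2⟩ := round_lem β (fun i => GB ℓ L (F i)) z z1 z2 z3 hbig
    refine match_lem hLn F hF f f1 ?_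
    intro a
    have h1 := f2 a
    have h2 : β + 3 * ((Fintype.card (Finset (Fin 3 → Fin L)) : ℝ) *
        (Fintype.card (Fin 3 → Fin L) : ℝ)) = ℓ := by
      rw [hβdef, hKdef, hK0]; push_cast; ring
    rw [h2] at h1
    exact_mod_cast h1
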